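/- arXiv:2302.04539 — 6 statements merged into one kernel-verified Lean document; each statement's English description precedes it below -/
import Mathlib

section
/- Let (X_k)_{k≥1} be a stationary ergodic process with values in a separable metric space S and marginal distribution F, and let h : S × S → ℝ be a symmetric kernel that is bounded and continuous F×F-almost everywhere. Then, almost surely, (1/binom(n,2)) ∑_{1≤i<j≤n} h(X_i, X_j) converges as n → ∞ to ∬ h(x,y) dF(x) dF(y). -/
open MeasureTheory Filter Topology

/-- Running maxima of Birkhoff sums. -/
noncomputable def bmax {α : Type*} (T : α → α) (g : α → ℝ) : ℕ → α → ℝ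
  | 0 => fun _ => 0
  | n + 1 => fun x => max 0 (g x + bmax T g n (T x))

lemma bmax_nonneg {α : Type*} (T : α → α) (g : α → ℝ) (n : ℕ) (x : α) : 0 ≤ bmax T g n x := by
  cases n with
  | zero => simp [bmax]
  | succ n => simp [bmax]

lemma bmax_le_succ {α : Type*} (T : α → α) (g : α → ℝ) (n : ℕ) (x : α) :
    bmax T g n x ≤ bmax T g (n + 1) x := by
  induction n generalizing x with
  | zero => simp [bmax]
  | succ n ih =>
    simp only [bmax] at ih ⊢
    exact max_le_max le_rfl (by linarith [ih (T x)])

lemma bmax_mono {α : Type*} (T : α → α) (g : α → ℝ) (x : α) :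
    Monotone (fun n => bmax T g n x) := monotone_nat_of_le_succ (fun n => bmax_le_succ T g n x)

lemma birkhoffSum_le_bmax {α : Type*} (T : α → α) (g : α → ℝ) (n : ℕ) (x : α) :
    birkhoffSum T g n x ≤ bmax T g n x := by
  induction n generalizing x with
  | zero => simp [bmax]
  | succ n ih =>
    rw [birkhoffSum_succ']
    simp only [bmax]
    exact le_max_of_le_right (by linarith [ih (T x)])

lemma bmax_le {α : Type*} (T : α → α) (g : α → ℝ) (C : ℝ) (hC : ∀ x, |g x| ≤ C) (n : ℕ) (x : α) :
    bmax T g n x ≤ n * C := by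
  induction n generalizing x with
  | zero => simp [bmax]
  | succ n ih =>
    have h0 : 0 ≤ C := (abs_nonneg _).trans (hC x)
    simp only [bmax]
    refine max_le (by positivity) ?_
    push_cast
    linarith [ih (T x), le_abs_self (g x), hC x]

lemma bmax_measurable {α : Type*} [MeasurableSpace α] {T : α → α} {g : α → ℝ}
    (hT : Measurable T) (hg : Measurable g) (n : ℕ) : Measurable (bmax T g n) := by
  induction n with
  | zero => exact measurable_const
  | succ n ih => exact measurable_const.max (hg.add (ih.comp hT))

/-- If `∫ g < 0` then the Birkhoff sums of `g` are a.e. bounded above. -/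
lemma ae_birkhoffSum_bdd {α : Type*} [MeasurableSpace α] {ν : Measure α} [IsProbabilityMeasure ν]
    {T : α → α} (hT : Ergodic T ν) {g : α → ℝ} (hg : Measurable g) (C : ℝ)
    (hC : ∀ x, |g x| ≤ C) (hneg : ∫ x, g x ∂ν < 0) :
    ∀ᵐ x ∂ν, ∃ k : ℕ, ∀ n, birkhoffSum T g n x ≤ k := by
  have hTm := hT.measurable
  set B : Set α := {x | ∃ k : ℕ, ∀ n, bmax T g n x ≤ k} with hB
  have hBm : MeasurableSet B := by
    have : B = ⋃ k : ℕ, ⋂ n, {x | bmax T g n x ≤ k} := by ext; simp [hB]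
    rw [this]
    exact MeasurableSet.iUnion fun k => MeasurableSet.iInter fun n =>
      measurableSet_le (bmax_measurable hTm hg n) measurable_const
  have hinv : T ⁻¹' B = B := by
    ext x
    constructor
    · rintro ⟨k, hk⟩
      obtain ⟨m, hm⟩ := exists_nat_ge (|g x| + k)
      refine ⟨m, fun n => (bmax_le_succ T g n x).trans ?_⟩
      simp only [bmax]
      refine max_le (by positivity) ?_
      linarith [hk n, le_abs_self (g x)]
    · rintro ⟨k, hk⟩
      obtain ⟨m, hm⟩ := exists_nat_ge (|g x| + k)
      refine ⟨m, fun n => ?_⟩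
      have h1 := hk (n + 1)
      simp only [bmax] at h1
      linarith [le_max_right 0 (g x + bmax T g n (T x)), neg_abs_le (g x)]
  have hint : ∀ n, Integrable (bmax T g n) ν := fun n =>
    Integrable.of_bound (bmax_measurable hTm hg n).aestronglyMeasurable (n * C)
      (ae_of_all _ fun x => by
        rw [Real.norm_eq_abs, abs_of_nonneg (bmax_nonneg T g n x)]
        exact bmax_le T g C hC n x)
  rcases hT.toPreErgodic.ae_mem_or_ae_notMem hBm hinv with h | h
  · filter_upwards [h] with x hx
    obtain ⟨k, hk⟩ := hx
    exact ⟨k, fun n => (birkhoffSum_le_bmax T g n x).trans (hk n)⟩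
  · exfalso
    have hlim : Tendsto (fun n => ∫ x, max (-bmax T g n (T x)) (g x) ∂ν) atTop
        (𝓝 (∫ x, g x ∂ν)) := by
      refine tendsto_integral_of_dominated_convergence (fun _ => C) ?_ (integrable_const C) ?_ ?_
      · exact fun n => (((bmax_measurable hTm hg n).comp hTm).neg.max hg).aestronglyMeasurable
      · refine fun n => ae_of_all _ fun x => ?_
        rw [Real.norm_eq_abs, abs_le]
        have h1 := abs_le.1 (hC x)
        have h2 := bmax_nonneg T g n (T x)
        exact ⟨h1.1.trans (le_max_right _ _), max_le (by linarith) h1.2⟩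
      · filter_upwards [h] with x hx
        have hx' : T x ∉ B := fun h' => hx (hinv ▸ h')
        obtain ⟨m, hm⟩ := exists_nat_ge (-g x)
        have : ∃ n, (m : ℝ) < bmax T g n (T x) := by
          by_contra! hcon
          exact hx' ⟨m, hcon⟩
        obtain ⟨N, hN⟩ := this
        refine tendsto_const_nhds.congr' ?_
        filter_upwards [eventually_ge_atTop N] with n hn
        rw [max_eq_right]
        have := bmax_mono T g (T x) hn
        simp only at this
        linarith
    have hpos : ∀ n, 0 ≤ ∫ x, max (-bmax T g n (T x)) (g x) ∂ν := by
      intro n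
      have e : ∀ x, max (-bmax T g n (T x)) (g x) = bmax T g (n + 1) x - bmax T g n (T x) := by
        intro x
        simp only [bmax]
        rw [← max_sub_sub_right]
        congr 1 <;> ring
      have hc : Integrable (fun x => bmax T g n (T x)) ν :=
        hT.toMeasurePreserving.integrable_comp_of_integrable (hint n)
      have he : ∫ x, bmax T g n (T x) ∂ν = ∫ x, bmax T g n x ∂ν := by
        have := integral_map (μ := ν) hTm.aemeasurable (f := bmax T g n)
          (bmax_measurable hTm hg n).aestronglyMeasurable
        rw [hT.map_eq] at this
        exact this.symm
      simp_rw [e]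
      rw [integral_sub (hint _) hc, he, sub_nonneg]
      exact integral_mono (hint n) (hint _) (fun x => bmax_le_succ T g n x)
    linarith [ge_of_tendsto' hlim hpos]

/-- One-sided Birkhoff theorem. -/
lemma ae_birkhoff_upper {α : Type*} [MeasurableSpace α] {ν : Measure α} [IsProbabilityMeasure ν]
    {T : α → α} (hT : Ergodic T ν) {f : α → ℝ} (hf : Measurable f) (C : ℝ)
    (hC : ∀ x, |f x| ≤ C) :
    ∀ᵐ x ∂ν, ∀ ε > 0, ∀ᶠ n : ℕ in atTop,
      birkhoffSum T f n x / n < (∫ x, f x ∂ν) + ε := by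
  have key : ∀ m : ℕ, ∀ᵐ x ∂ν, ∃ k : ℕ, ∀ n,
      birkhoffSum T (fun x => f x - ((∫ x, f x ∂ν) + 1 / ((m : ℝ) + 1))) n x ≤ k := by
    intro m
    have hi : Integrable f ν := Integrable.of_bound hf.aestronglyMeasurable C (ae_of_all _ hC)
    refine ae_birkhoffSum_bdd hT (hf.sub_const _) (C + |(∫ x, f x ∂ν) + 1 / ((m : ℝ) + 1)|)
      (fun x => (abs_sub _ _).trans (by linarith [hC x])) ?_
    rw [integral_sub hi (integrable_const _)]
    simp
    positivity
  filter_upwards [ae_all_iff.2 key] with x hx ε hε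
  obtain ⟨m, hm⟩ := exists_nat_one_div_lt (half_pos hε)
  obtain ⟨k, hk⟩ := hx m
  have h1 : Tendsto (fun n : ℕ => (k : ℝ) / n) atTop (𝓝 0) := tendsto_const_div_atTop_nhds_zero_nat _
  filter_upwards [h1.eventually (gt_mem_nhds (half_pos hε)), eventually_gt_atTop 0] with n hn hn0
  have hn0' : (0 : ℝ) < n := by exact_mod_cast hn0
  have h2 := hk n
  simp only [birkhoffSum, Finset.sum_sub_distrib, Finset.sum_const, Finset.card_range,
    nsmul_eq_mul] at h2 ⊢
  rw [div_lt_iff₀ hn0'] at hn ⊢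
  nlinarith

/-- Birkhoff's theorem for bounded functions and ergodic transformations. -/
lemma ae_birkhoff {α : Type*} [MeasurableSpace α] {ν : Measure α} [IsProbabilityMeasure ν]
    {T : α → α} (hT : Ergodic T ν) {f : α → ℝ} (hf : Measurable f) (C : ℝ)
    (hC : ∀ x, |f x| ≤ C) :
    ∀ᵐ x ∂ν, Tendsto (fun n : ℕ => birkhoffSum T f n x / n) atTop (𝓝 (∫ x, f x ∂ν)) := by
  filter_upwards [ae_birkhoff_upper hT hf C hC,
    ae_birkhoff_upper hT hf.neg C (fun x => by simpa using hC x)] with x h1 h2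
  rw [tendsto_order]
  constructor
  · intro a ha
    filter_upwards [h2 _ (sub_pos.2 ha)] with n hn
    have e : birkhoffSum T (-f) n x = - birkhoffSum T f n x := by simp [birkhoffSum]
    have e2 : ∫ x, (-f) x ∂ν = -∫ x, f x ∂ν := by simp [integral_neg]
    rw [e, e2, neg_div] at hn
    linarith
  · intro a ha
    filter_upwards [h1 _ (sub_pos.2 ha)] with n hn
    linarith

/-- A.e. continuous mapping for bounded functions. -/
lemma tendsto_integral_of_ae_continuousAt {E : Type*} [MetricSpace E] [MeasurableSpace E]
    [BorelSpace E] {Q : ℕ → ProbabilityMeasure E} {P : ProbabilityMeasure E}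
    (hQ : Tendsto Q atTop (𝓝 P)) {f : E → ℝ} (hf : Measurable f) (C : ℝ) (hC : ∀ x, |f x| ≤ C)
    (hcont : ∀ᵐ p ∂(P : Measure E), ContinuousAt f p) :
    Tendsto (fun n => ∫ x, f x ∂(Q n : Measure E)) atTop (𝓝 (∫ x, f x ∂(P : Measure E))) := by
  have hmap : Tendsto (fun n => (Q n).map hf.aemeasurable) atTop (𝓝 (P.map hf.aemeasurable)) := by
    refine tendsto_of_forall_isClosed_limsup_le' fun G hG => ?_
    simp only [ProbabilityMeasure.toMeasure_map, Measure.map_apply hf hG.measurableSet]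
    calc limsup (fun i => (Q i : Measure E) (f ⁻¹' G)) atTop
        ≤ limsup (fun i => (Q i : Measure E) (closure (f ⁻¹' G))) atTop :=
          limsup_le_limsup (Eventually.of_forall fun i => measure_mono subset_closure)
      _ ≤ (P : Measure E) (closure (f ⁻¹' G)) :=
          ProbabilityMeasure.limsup_measure_closed_le_of_tendsto hQ isClosed_closure
      _ ≤ (P : Measure E) (f ⁻¹' G) := by
          refine measure_mono_ae ?_
          filter_upwards [hcont] with x hx hxc
          have := hx.continuousWithinAt.mem_closure_image (s := f ⁻¹' G) hxc
          exact hG.closure_subset_iff.2 (Set.image_preimage_subset f G) this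
  let φ : BoundedContinuousFunction ℝ ℝ := BoundedContinuousFunction.ofNormedAddCommGroup
    (fun t => max (-C) (min C t)) (by fun_prop) (|C|) (fun t => by
      rw [Real.norm_eq_abs, abs_le]
      refine ⟨(neg_le_neg (le_abs_self C)).trans (le_max_left _ _), ?_⟩
      · exact max_le (neg_le_abs C) ((min_le_left _ _).trans (le_abs_self C)))
  have h1 := ProbabilityMeasure.tendsto_iff_forall_integral_tendsto.1 hmap φ
  have e : ∀ R : ProbabilityMeasure E, ∫ t, φ t ∂((R.map hf.aemeasurable : ProbabilityMeasure ℝ) :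
      Measure ℝ) = ∫ x, f x ∂(R : Measure E) := by
    intro R
    rw [ProbabilityMeasure.toMeasure_map, integral_map hf.aemeasurable
      φ.continuous.aestronglyMeasurable]
    refine integral_congr_ae (ae_of_all _ fun x => ?_)
    have := abs_le.1 (hC x)
    change max (-C) (min C (f x)) = f x
    rw [min_eq_right this.2, max_eq_right this.1]
  simpa only [e] using h1

open scoped ENNReal in
/-- The empirical measure of the first `n + 1` points of a sequence. -/
noncomputable def empM {S : Type*} [MeasurableSpace S] (x : ℕ → S) (n : ℕ) : Measure S :=
  ((n : ℝ≥0∞) + 1)⁻¹ • ∑ i ∈ Finset.range (n + 1), Measure.dirac (x i)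

instance empM_prob {S : Type*} [MeasurableSpace S] (x : ℕ → S) (n : ℕ) :
    IsProbabilityMeasure (empM x n) := by
  constructor
  simp only [empM, Measure.smul_apply, Measure.finsetSum_apply, measure_univ, smul_eq_mul]
  simp only [Finset.sum_const, Finset.card_range, nsmul_eq_mul, mul_one]
  push_cast
  exact ENNReal.inv_mul_cancel (by simp) (by finiteness)

/-- The empirical measure as a bundled probability measure. -/
noncomputable def empP {S : Type*} [MeasurableSpace S] (x : ℕ → S) (n : ℕ) :
    ProbabilityMeasure S := ⟨empM x n, empM_prob x n⟩

lemma integral_empM {S : Type*} [MeasurableSpace S] [MeasurableSingletonClass S]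
    (x : ℕ → S) (n : ℕ) (f : S → ℝ) :
    ∫ y, f y ∂(empM x n) = ((n : ℝ) + 1)⁻¹ * ∑ i ∈ Finset.range (n + 1), f (x i) := by
  rw [empM, integral_smul_measure, integral_finsetSum_measure]
  · have : ((n : ENNReal) + 1).toReal = (n : ℝ) + 1 := by
      rw [ENNReal.toReal_add] <;> simp
    simp [this]
  · exact fun i _ => integrable_dirac (by simp)

/-- A sequence of empirical measures converging on a suitable countable family of sets. -/
lemma tendsto_empM {S : Type*} [MetricSpace S] [TopologicalSpace.SeparableSpace S]
    [MeasurableSpace S] [BorelSpace S] {α : Type*} [MeasurableSpace α] {ν : Measure α}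
    [IsProbabilityMeasure ν] {T : α → α} (hT : Ergodic T ν) (π : α → S) (hπ : Measurable π)
    (P : ProbabilityMeasure S) (hP : (P : Measure S) = ν.map π) :
    ∀ᵐ x ∂ν, Tendsto (fun n => empP (fun i => π (T^[i] x)) n) atTop (𝓝 P) := by
  have : SecondCountableTopology S := UniformSpace.secondCountable_of_separable S
  set B := TopologicalSpace.countableBasis S with hB
  set D : Set (Set S) := (fun t => ⋂₀ t) '' {t : Set (Set S) | t.Finite ∧ t ⊆ B} with hDD
  have hc : D.Countable :=
    (Set.countable_ofPred_finite_subset (TopologicalSpace.countable_countableBasis S)).image _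
  have hm : ∀ s ∈ D, MeasurableSet s := by
    rintro s ⟨t, ⟨ht, htB⟩, rfl⟩
    exact MeasurableSet.sInter ht.countable fun u hu =>
      (TopologicalSpace.isOpen_of_mem_countableBasis (htB hu)).measurableSet
  have hpi : IsPiSystem D := by
    rintro _ ⟨t, ⟨ht, htB⟩, rfl⟩ _ ⟨t', ⟨ht', htB'⟩, rfl⟩ _
    exact ⟨t ∪ t', ⟨ht.union ht', Set.union_subset htB htB'⟩, Set.sInter_union t t'⟩
  have hae : ∀ᵐ x ∂ν, ∀ s ∈ D, Tendsto (fun n : ℕ =>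
      birkhoffSum T (fun a => s.indicator (fun _ => (1 : ℝ)) (π a)) n x / n) atTop
      (𝓝 (∫ a, s.indicator (fun _ => (1 : ℝ)) (π a) ∂ν)) := by
    rw [ae_ball_iff hc]
    intro s hs
    refine ae_birkhoff hT ((measurable_const.indicator (hm s hs)).comp hπ) 1 fun a => ?_
    by_cases h : π a ∈ s <;> simp [h]
  filter_upwards [hae] with x hx
  refine hpi.tendsto_probabilityMeasure_of_tendsto_of_mem hm ?_ ?_
  · intro u hu y hy
    obtain ⟨s, hs, hys, hsu⟩ :=
      (TopologicalSpace.isBasis_countableBasis S).exists_subset_of_mem_open hy hu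
    exact ⟨s, ⟨{s}, ⟨Set.finite_singleton s, by simpa using hs⟩, by simp⟩,
      (TopologicalSpace.isOpen_of_mem_countableBasis hs).mem_nhds hys, hsu⟩
  · intro s hs
    rw [← NNReal.tendsto_coe]
    simp only [← ProbabilityMeasure.measureReal_eq_coe_coeFn]
    have h1 := (tendsto_add_atTop_iff_nat 1).2 (hx s hs)
    have e1 : ∫ a, s.indicator (fun _ => (1 : ℝ)) (π a) ∂ν = (P : Measure S).real s := by
      rw [hP, ← integral_indicator_one (hm s hs), integral_map hπ.aemeasurable]
      · rfl
      · exact (measurable_const.indicator (hm s hs)).aestronglyMeasurable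
    rw [e1] at h1
    refine h1.congr fun n => ?_
    simp only [empP, ProbabilityMeasure.coe_mk]
    rw [← integral_indicator_one (hm s hs), integral_empM]
    simp only [birkhoffSum]
    push_cast
    rw [div_eq_inv_mul]
    rfl

lemma integral_empM_prod {S : Type*} [MeasurableSpace S] [MeasurableSingletonClass S]
    (x : ℕ → S) (n : ℕ) (f : S × S → ℝ) (hf : Measurable f) (C : ℝ) (hC : ∀ p, |f p| ≤ C) :
    ∫ p, f p ∂((empM x n).prod (empM x n)) = (((n : ℝ) + 1) ^ 2)⁻¹ *
      ∑ i ∈ Finset.range (n + 1), ∑ j ∈ Finset.range (n + 1), f (x i, x j) := by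
  rw [integral_prod _ (Integrable.of_bound hf.aestronglyMeasurable C (ae_of_all _ hC))]
  simp only [integral_empM, ← Finset.mul_sum]
  rw [← mul_assoc, sq, mul_inv]

lemma double_sum_eq {S : Type*} (h : S → S → ℝ) (hsymm : ∀ x y, h x y = h y x) (x : ℕ → S)
    (n : ℕ) :
    ∑ i ∈ Finset.range n, ∑ j ∈ Finset.range n, h (x (i + 1)) (x (j + 1)) =
      2 * ∑ j ∈ Finset.Icc 1 n, ∑ i ∈ Finset.Ico 1 j, h (x i) (x j) +
        ∑ i ∈ Finset.range n, h (x (i + 1)) (x (i + 1)) := by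
  induction n with
  | zero => simp
  | succ n ih =>
    have e : ∑ i ∈ Finset.Ico 1 (n + 1), h (x i) (x (n + 1)) =
        ∑ i ∈ Finset.range n, h (x (i + 1)) (x (n + 1)) := by
      rw [Finset.sum_Ico_eq_sum_range]
      simp [add_comm]
    have e2 : ∑ i ∈ Finset.range n, h (x (n + 1)) (x (i + 1)) =
        ∑ i ∈ Finset.range n, h (x (i + 1)) (x (n + 1)) :=
      Finset.sum_congr rfl fun i _ => hsymm _ _
    rw [Finset.sum_Icc_succ_top (by omega), e, Finset.sum_range_succ, Finset.sum_range_succ,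
      Finset.sum_range_succ (fun i => h (x (i + 1)) (x (i + 1)))]
    simp only [Finset.sum_range_succ _ n, Finset.sum_add_distrib]
    rw [ih, e2]
    ring

/-- The U-statistics ergodic theorem for bounded, `F × F`-a.e. continuous symmetric
kernels, for a stationary ergodic process with values in a separable metric space.
Stationarity and ergodicity of `(X_k)_{k ≥ 1}` are encoded by requiring that the law of
the path `(X_1, X_2, …)` is invariant and ergodic under the one-sided shift. -/
theorem stmt0 {Ω : Type*} [MeasurableSpace Ω] (μ : Measure Ω) [IsProbabilityMeasure μ]
    {S : Type*} [MetricSpace S] [TopologicalSpace.SeparableSpace S]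
    [MeasurableSpace S] [BorelSpace S]
    (X : ℕ → Ω → S) (hXmeas : ∀ k, Measurable (X k))
    (hX : Ergodic (fun u : ℕ → S => fun n => u (n + 1))
      (Measure.map (fun ω => fun n => X (n + 1) ω) μ))
    (F : Measure S) (hF : F = Measure.map (X 1) μ)
    (h : S → S → ℝ)
    (hmeas : Measurable (Function.uncurry h))
    (hsymm : ∀ x y, h x y = h y x)
    (hbdd : ∃ C : ℝ, ∀ x y, |h x y| ≤ C)
    (hcont : ∀ᵐ p ∂(F.prod F), ContinuousAt (Function.uncurry h) p) :
    ∀ᵐ ω ∂μ, Tendsto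
      (fun n : ℕ => (n.choose 2 : ℝ)⁻¹ *
        ∑ j ∈ Finset.Icc 1 n, ∑ i ∈ Finset.Ico 1 j, h (X i ω) (X j ω))
      atTop (𝓝 (∫ p, h p.1 p.2 ∂(F.prod F))) := by
  obtain ⟨C, hC⟩ := hbdd
  have : SecondCountableTopology S := UniformSpace.secondCountable_of_separable S
  have hYm : Measurable (fun ω => fun n => X (n + 1) ω) :=
    measurable_pi_lambda _ fun n => hXmeas (n + 1)
  have : IsProbabilityMeasure (Measure.map (fun ω => fun n => X (n + 1) ω) μ) :=
    Measure.isProbabilityMeasure_map hYm.aemeasurable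
  have : IsProbabilityMeasure F := hF ▸ Measure.isProbabilityMeasure_map (hXmeas 1).aemeasurable
  have hw := tendsto_empM hX (fun u => u 0) (measurable_pi_apply 0) ⟨F, inferInstance⟩ (by
    rw [Measure.map_map (measurable_pi_apply 0) hYm]
    exact hF)
  have hw' := ae_of_ae_map hYm.aemeasurable hw
  have hit : ∀ (i : ℕ) (u : ℕ → S), (fun u : ℕ → S => fun n => u (n + 1))^[i] u 0 = u i := by
    have : ∀ (i : ℕ) (u : ℕ → S) (k : ℕ),
        (fun u : ℕ → S => fun n => u (n + 1))^[i] u k = u (k + i) := by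
      intro i
      induction i with
      | zero => simp
      | succ i ih =>
        intro u k
        rw [Function.iterate_succ_apply, ih]
        rfl
    intro i u
    rw [this, zero_add]
  simp only [hit] at hw'
  filter_upwards [hw'] with ω hω
  set x : ℕ → S := fun i => X i ω with hx
  have hprod := (ProbabilityMeasure.continuous_prod (α := S) (β := S)).continuousAt.tendsto.comp
    (hω.prodMk_nhds hω)
  have hlim := tendsto_integral_of_ae_continuousAt hprod hmeas C (fun p => hC p.1 p.2) hcont
  have hlim1 : Tendsto (fun n : ℕ => (((n : ℝ) + 1) ^ 2)⁻¹ *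
      ∑ i ∈ Finset.range (n + 1), ∑ j ∈ Finset.range (n + 1), h (x (i + 1)) (x (j + 1))) atTop
      (𝓝 (∫ p, h p.1 p.2 ∂(F.prod F))) := by
    refine hlim.congr fun n => ?_
    exact integral_empM_prod (fun i => X (i + 1) ω) n (Function.uncurry h) hmeas C
      (fun p => hC p.1 p.2)
  have hdiag : Tendsto (fun n : ℕ => (((n : ℝ) + 1) ^ 2)⁻¹ *
      ∑ i ∈ Finset.range (n + 1), h (x (i + 1)) (x (i + 1))) atTop (𝓝 0) := by
    have h0 : Tendsto (fun n : ℕ => C * (1 / ((n : ℝ) + 1))) atTop (𝓝 0) := by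
      simpa using (tendsto_one_div_add_atTop_nhds_zero_nat (𝕜 := ℝ)).const_mul C
    refine squeeze_zero_norm (fun n => ?_) h0
    have hb : |∑ i ∈ Finset.range (n + 1), h (x (i + 1)) (x (i + 1))| ≤ ((n : ℝ) + 1) * C := by
      refine (Finset.abs_sum_le_sum_abs _ _).trans ((Finset.sum_le_sum fun i _ => hC _ _).trans ?_)
      simp
    have hp : (0 : ℝ) < (n : ℝ) + 1 := by positivity
    rw [Real.norm_eq_abs, abs_mul, abs_of_pos (by positivity)]
    calc (((n : ℝ) + 1) ^ 2)⁻¹ * _ ≤ (((n : ℝ) + 1) ^ 2)⁻¹ * (((n : ℝ) + 1) * C) := by gcongr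
      _ = C * (1 / ((n : ℝ) + 1)) := by field_simp
  have hratio : Tendsto (fun n : ℕ => ((n : ℝ) + 1) / n) atTop (𝓝 1) := by
    have h0 : Tendsto (fun n : ℕ => 1 + 1 / (n : ℝ)) atTop (𝓝 (1 + 0)) :=
      tendsto_const_nhds.add tendsto_one_div_atTop_nhds_zero_nat
    rw [add_zero] at h0
    refine h0.congr' ?_
    filter_upwards [eventually_gt_atTop 0] with n hn
    have : (n : ℝ) ≠ 0 := by positivity
    field_simp
  have hfin := (hlim1.sub hdiag).mul hratio
  rw [sub_zero, mul_one] at hfin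
  rw [← tendsto_add_atTop_iff_nat 1]
  refine hfin.congr' ?_
  filter_upwards [eventually_gt_atTop 0] with n hn
  have hn' : (n : ℝ) ≠ 0 := by positivity
  have hp : (n : ℝ) + 1 ≠ 0 := by positivity
  rw [double_sum_eq h hsymm x (n + 1), Nat.cast_choose_two]
  push_cast
  rw [add_sub_cancel_right]
  field_simp
  ring
end

section
/- Let (X_i)_{i≥1} be a stationary ergodic sequence taking values in ℝ^d with marginal distribution F, and let h : ℝ^d × ℝ^d → ℝ be a measurable symmetric function that is continuous F×F-almost everywhere, such that the family {h(X_1, X_j) : j ≥ 1} is uniformly integrable. Then E| (1/binom(n,2)) ∑_{1≤i<j≤n} h(X_i, X_j) − ∬ h(x,y) dF(x) dF(y) | → 0 as n → ∞. -/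
open MeasureTheory Filter Topology

lemma Lp_integral_abs_le {α : Type*} [MeasurableSpace α] (ν : Measure α) [IsProbabilityMeasure ν]
    (g : Lp ℝ 2 ν) : ∫ x, |g x| ∂ν ≤ ‖g‖ := by
  rw [Lp.norm_def]
  have h1 : ∫ x, |g x| ∂ν = (eLpNorm g 1 ν).toReal := by
    rw [eLpNorm_one_eq_lintegral_enorm, ← integral_norm_eq_lintegral_enorm]
    · rfl
    · exact Lp.aestronglyMeasurable g
  rw [h1]
  apply ENNReal.toReal_mono (Lp.eLpNorm_ne_top g)
  exact eLpNorm_le_eLpNorm_of_exponent_le (by norm_num) (Lp.aestronglyMeasurable g)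

lemma mean_ergodic_L1 {α : Type*} [MeasurableSpace α] (ν : Measure α) [IsProbabilityMeasure ν]
    (T : α → α) (hT : Ergodic T ν) (f : α → ℝ) (hf : MemLp f 2 ν) :
    Tendsto (fun n : ℕ => ∫ x, |(n : ℝ)⁻¹ * ∑ k ∈ Finset.range n, f (T^[k] x) - ∫ y, f y ∂ν| ∂ν)
      atTop (𝓝 0) := by
  have hmp := hT.toMeasurePreserving
  set K : Lp ℝ 2 ν →L[ℝ] Lp ℝ 2 ν :=
    (Lp.compMeasurePreservingₗᵢ ℝ T hmp).toContinuousLinearMap with hK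
  have hKn : ‖K‖ ≤ 1 :=
    ContinuousLinearMap.opNorm_le_bound _ zero_le_one (fun x => by
      rw [one_mul]; exact (Lp.norm_compMeasurePreserving x hmp).le)
  have hlim := K.tendsto_birkhoffAverage_orthogonalProjection hKn (hf.toLp f)
  set L := (K.eqLocus (1 : Lp ℝ 2 ν →L[ℝ] Lp ℝ 2 ν)).orthogonalProjectionOnto (hf.toLp f) with hL
  obtain ⟨c, hc⟩ : ∃ c : ℝ, ((L : Lp ℝ 2 ν) : α → ℝ) =ᵐ[ν] Function.const α c := by
    apply hT.ae_eq_const_of_ae_eq_comp_ae (Lp.aestronglyMeasurable _)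
    have h1 : K (L : Lp ℝ 2 ν) = (L : Lp ℝ 2 ν) := L.2
    have h2 : Lp.compMeasurePreserving T hmp (L : Lp ℝ 2 ν) = (L : Lp ℝ 2 ν) := h1
    have h3 := Lp.coeFn_compMeasurePreserving (L : Lp ℝ 2 ν) hmp
    rw [h2] at h3
    exact h3.symm
  have hA : ∀ n : ℕ, ((birkhoffAverage ℝ K _root_.id n (hf.toLp f) : Lp ℝ 2 ν) : α → ℝ) =ᵐ[ν]
      fun x => (n : ℝ)⁻¹ * ∑ k ∈ Finset.range n, f (T^[k] x) := by
    intro n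
    have h1 : ∀ k, ((K^[k] (hf.toLp f) : Lp ℝ 2 ν) : α → ℝ) =ᵐ[ν] fun x => f (T^[k] x) := by
      intro k
      have : K^[k] (hf.toLp f) = Lp.compMeasurePreserving T^[k] (hmp.iterate k) (hf.toLp f) := by
        rw [← Lp.compMeasurePreserving_iterate]; rfl
      rw [this, Lp.toLp_compMeasurePreserving]
      exact MemLp.coeFn_toLp _
    have h2 := ae_all_iff.2 h1
    unfold birkhoffAverage birkhoffSum
    filter_upwards [h2, Lp.coeFn_smul ((n:ℝ)⁻¹) (∑ k ∈ Finset.range n, (_root_.id (K^[k] (hf.toLp f)))),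
      Lp.coeFn_finsetSum (Finset.range n) (fun k => _root_.id (K^[k] (hf.toLp f)))] with x hx hx2 hx3
    rw [hx2, Pi.smul_apply, hx3]
    simp [hx]
  have hbd : ∀ n : ℕ, ∫ x, |(n : ℝ)⁻¹ * ∑ k ∈ Finset.range n, f (T^[k] x) - c| ∂ν ≤
      ‖birkhoffAverage ℝ K _root_.id n (hf.toLp f) - L‖ := by
    intro n
    refine le_trans (le_of_eq ?_) (Lp_integral_abs_le ν _)
    apply integral_congr_ae
    filter_upwards [hA n, hc, Lp.coeFn_sub (birkhoffAverage ℝ K _root_.id n (hf.toLp f)) (L : Lp ℝ 2 ν)] with x h1 h2 h3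
    rw [h3, Pi.sub_apply, h1, h2]; rfl
  have hnorm : Tendsto (fun n => ‖birkhoffAverage ℝ K _root_.id n (hf.toLp f) - L‖) atTop (𝓝 0) :=
    tendsto_iff_norm_sub_tendsto_zero.1 hlim
  have hfk : ∀ k, Integrable (fun x => f (T^[k] x)) ν := fun k =>
    (hf.comp_measurePreserving (hmp.iterate k)).integrable (by norm_num)
  have hcl : Tendsto (fun n : ℕ => ∫ x, |(n : ℝ)⁻¹ * ∑ k ∈ Finset.range n, f (T^[k] x) - c| ∂ν)
      atTop (𝓝 0) :=
    squeeze_zero (fun n => integral_nonneg fun x => abs_nonneg _) hbd hnorm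
  have hceq : c = ∫ y, f y ∂ν := by
    have : Tendsto (fun n : ℕ => |∫ y, f y ∂ν - c|) atTop (𝓝 0) := by
      refine squeeze_zero' (Eventually.of_forall fun n => abs_nonneg _) ?_ hcl
      filter_upwards [eventually_gt_atTop 0] with n hn
      have hi : Integrable (fun x => (n : ℝ)⁻¹ * ∑ k ∈ Finset.range n, f (T^[k] x)) ν :=
        (integrable_finsetSum _ fun k _ => hfk k).const_mul _
      have : ∫ y, f y ∂ν - c = ∫ x, ((n : ℝ)⁻¹ * ∑ k ∈ Finset.range n, f (T^[k] x) - c) ∂ν := by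
        rw [integral_sub hi (integrable_const _), integral_const_mul,
          integral_finsetSum _ (fun k _ => hfk k)]
        have : ∀ k, ∫ x, f (T^[k] x) ∂ν = ∫ y, f y ∂ν := by
          intro k
          have hk := hmp.iterate k
          have := integral_map (μ := ν) (φ := T^[k]) hk.measurable.aemeasurable (f := f)
            (by rw [hk.map_eq]; exact hf.1)
          rw [← this, hk.map_eq]
        simp only [this]
        have : (n:ℝ) ≠ 0 := by positivity
        simp [this]
      rw [this]
      exact abs_integral_le_integral_abs
    have := tendsto_nhds_unique this tendsto_const_nhds
    have := abs_eq_zero.1 this.symm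
    linarith
  rw [← hceq]; exact hcl

lemma Vstat_cell {Ω E ι : Type*} [MeasurableSpace Ω] [MeasurableSpace E] (μ : Measure Ω)
    [IsProbabilityMeasure μ] (F : Measure E) [IsProbabilityMeasure F]
    (Y : ℕ → Ω → E) (hY : ∀ k, Measurable (Y k))
    (hLLN : ∀ A : Set E, MeasurableSet A → Tendsto (fun n : ℕ =>
      ∫ ω, |(n : ℝ)⁻¹ * ∑ k ∈ Finset.range n, A.indicator (fun _ => (1 : ℝ)) (Y k ω) - F.real A| ∂μ)
        atTop (𝓝 0))
    [Fintype ι] [MeasurableSpace ι] [MeasurableSingletonClass ι] (q : E → ι) (hq : Measurable q)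
    (s : ι → ι → ℝ) :
    Tendsto (fun n : ℕ => ∫ ω, |(n : ℝ)⁻¹ * ((n : ℝ)⁻¹ * ∑ i ∈ Finset.range n,
      ∑ j ∈ Finset.range n, s (q (Y i ω)) (q (Y j ω)))
        - ∫ p, s (q p.1) (q p.2) ∂(F.prod F)| ∂μ) atTop (𝓝 0) := by
  classical
  set I : ι → E → ℝ := fun a => (q ⁻¹' {a}).indicator (fun _ => (1 : ℝ)) with hI
  have hAm : ∀ a, MeasurableSet (q ⁻¹' {a}) := fun a => hq (measurableSet_singleton a)
  have hIm : ∀ a, Measurable (I a) := fun a => measurable_const.indicator (hAm a)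
  have hI0 : ∀ a x, 0 ≤ I a x := fun a x => Set.indicator_nonneg (fun _ _ => zero_le_one) x
  have hI1 : ∀ a x, I a x ≤ 1 := fun a x => Set.indicator_le_self' (fun _ _ => zero_le_one) x
  have hg : ∀ x y, s (q x) (q y) = ∑ a, ∑ b, s a b * (I a x * I b y) := by
    intro x y
    simp [hI, Set.indicator_apply, eq_comm]
  have hIint : ∀ a, Integrable (I a) F := fun a =>
    (integrable_const (1 : ℝ)).indicator (hAm a)
  have hint : ∫ p, s (q p.1) (q p.2) ∂(F.prod F) =
      ∑ a, ∑ b, s a b * (F.real (q ⁻¹' {a}) * F.real (q ⁻¹' {b})) := by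
    simp only [hg]
    have hi : ∀ a b, Integrable (fun p : E × E => s a b * (I a p.1 * I b p.2)) (F.prod F) :=
      fun a b => ((hIint a).mul_prod (hIint b)).const_mul _
    rw [integral_finsetSum _ (fun a _ => integrable_finsetSum _ fun b _ => hi a b)]
    refine Finset.sum_congr rfl fun a _ => ?_
    rw [integral_finsetSum _ (fun b _ => hi a b)]
    refine Finset.sum_congr rfl fun b _ => ?_
    rw [integral_const_mul, integral_prod_mul]
    congr 2
    · simp only [hI]; rw [integral_indicator (hAm a)]; simp
    · simp only [hI]; rw [integral_indicator (hAm b)]; simp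
  set P : ι → ℕ → Ω → ℝ := fun a n ω => (n : ℝ)⁻¹ * ∑ k ∈ Finset.range n, I a (Y k ω) with hP
  have hV : ∀ (n : ℕ) ω, (n : ℝ)⁻¹ * ((n : ℝ)⁻¹ * ∑ i ∈ Finset.range n,
      ∑ j ∈ Finset.range n, s (q (Y i ω)) (q (Y j ω))) =
      ∑ a, ∑ b, s a b * (P a n ω * P b n ω) := by
    intro n ω
    simp only [hg]
    have : ∑ i ∈ Finset.range n, ∑ j ∈ Finset.range n, ∑ a, ∑ b,
        s a b * (I a (Y i ω) * I b (Y j ω)) = ∑ a, ∑ b, s a b *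
          ((∑ i ∈ Finset.range n, I a (Y i ω)) * ∑ j ∈ Finset.range n, I b (Y j ω)) := by
      rw [Finset.sum_congr rfl (fun i _ => Finset.sum_comm), Finset.sum_comm]
      refine Finset.sum_congr rfl fun a _ => ?_
      rw [Finset.sum_congr rfl (fun i _ => Finset.sum_comm), Finset.sum_comm]
      refine Finset.sum_congr rfl fun b _ => ?_
      rw [Finset.sum_mul_sum, Finset.mul_sum]
      refine Finset.sum_congr rfl fun i _ => ?_
      rw [Finset.mul_sum]
    rw [this, Finset.mul_sum, Finset.mul_sum]
    refine Finset.sum_congr rfl fun a _ => ?_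
    rw [Finset.mul_sum, Finset.mul_sum]
    refine Finset.sum_congr rfl fun b _ => ?_
    simp only [hP]
    ring
  have hP0 : ∀ a n ω, 0 ≤ P a n ω := fun a n ω =>
    mul_nonneg (by positivity) (Finset.sum_nonneg fun k _ => hI0 _ _)
  have hP1 : ∀ a n ω, P a n ω ≤ 1 := by
    intro a n ω
    simp only [hP]
    rcases Nat.eq_zero_or_pos n with h0 | h0
    · simp [h0]
    · rw [inv_mul_le_iff₀ (by positivity), mul_one]
      calc _ ≤ ∑ k ∈ Finset.range n, (1 : ℝ) := Finset.sum_le_sum fun k _ => hI1 _ _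
        _ = n := by simp
  have hPm : ∀ a n, Measurable (P a n) := fun a n => by
    simp only [hP]
    exact (Finset.measurable_fun_sum _ fun k _ => (hIm a).comp (hY k)).const_mul _
  have hPi : ∀ a n, Integrable (fun ω => |P a n ω - F.real (q ⁻¹' {a})|) μ := fun a n => by
    refine ((Integrable.of_bound (hPm a n).aestronglyMeasurable 1 ?_).sub (integrable_const _)).abs
    exact Eventually.of_forall fun ω => by
      rw [Real.norm_eq_abs, abs_of_nonneg (hP0 _ _ _)]; exact hP1 _ _ _
  have hlim : Tendsto (fun n : ℕ => ∑ a, ∑ b, |s a b| *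
      (∫ ω, |P a n ω - F.real (q ⁻¹' {a})| ∂μ + ∫ ω, |P b n ω - F.real (q ⁻¹' {b})| ∂μ))
      atTop (𝓝 0) := by
    have : (0 : ℝ) = ∑ a : ι, ∑ b : ι, |s a b| * (0 + 0) := by simp
    rw [this]
    refine tendsto_finsetSum _ fun a _ => tendsto_finsetSum _ fun b _ => ?_
    exact ((hLLN _ (hAm a)).add (hLLN _ (hAm b))).const_mul _
  refine squeeze_zero (fun n => integral_nonneg fun x => abs_nonneg _) (fun n => ?_) hlim
  have hie : ∀ a b, Integrable (fun ω => |s a b| *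
      (|P a n ω - F.real (q ⁻¹' {a})| + |P b n ω - F.real (q ⁻¹' {b})|)) μ := fun a b =>
    ((hPi a n).add (hPi b n)).const_mul _
  have hR : ∑ a, ∑ b, |s a b| *
      (∫ ω, |P a n ω - F.real (q ⁻¹' {a})| ∂μ + ∫ ω, |P b n ω - F.real (q ⁻¹' {b})| ∂μ) =
      ∫ ω, ∑ a, ∑ b, |s a b| *
      (|P a n ω - F.real (q ⁻¹' {a})| + |P b n ω - F.real (q ⁻¹' {b})|) ∂μ := by
    rw [integral_finsetSum _ (fun a _ => integrable_finsetSum _ fun b _ => hie a b)]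
    refine Finset.sum_congr rfl fun a _ => ?_
    rw [integral_finsetSum _ (fun b _ => hie a b)]
    refine Finset.sum_congr rfl fun b _ => ?_
    rw [integral_const_mul, integral_add (hPi a n) (hPi b n)]
  rw [hR]
  refine integral_mono_of_nonneg (Eventually.of_forall fun _ => abs_nonneg _)
    (integrable_finsetSum _ fun a _ => integrable_finsetSum _ fun b _ => hie a b)
    (Eventually.of_forall fun ω => ?_)
  simp only
  rw [hV, hint, ← Finset.sum_sub_distrib]
  refine (Finset.abs_sum_le_sum_abs _ _).trans (Finset.sum_le_sum fun a _ => ?_)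
  rw [← Finset.sum_sub_distrib]
  refine (Finset.abs_sum_le_sum_abs _ _).trans (Finset.sum_le_sum fun b _ => ?_)
  rw [← mul_sub, abs_mul]
  refine mul_le_mul_of_nonneg_left ?_ (abs_nonneg _)
  have e : P a n ω * P b n ω - F.real (q ⁻¹' {a}) * F.real (q ⁻¹' {b}) =
    (P a n ω - F.real (q ⁻¹' {a})) * P b n ω + F.real (q ⁻¹' {a}) * (P b n ω - F.real (q ⁻¹' {b})) := by
    ring
  rw [e]
  refine (abs_add_le _ _).trans (add_le_add ?_ ?_)
  · rw [abs_mul]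
    exact mul_le_of_le_one_right (abs_nonneg _) (by rw [abs_of_nonneg (hP0 _ _ _)]; exact hP1 _ _ _)
  · rw [abs_mul]
    exact mul_le_of_le_one_left (abs_nonneg _)
      (by rw [abs_of_nonneg measureReal_nonneg]; exact measureReal_le_one)

/-- The V-statistic. -/
noncomputable def Vst {Ω E : Type*} (Y : ℕ → Ω → E) (φ : E → E → ℝ) (n : ℕ) (ω : Ω) : ℝ :=
  (n : ℝ)⁻¹ * ((n : ℝ)⁻¹ * ∑ i ∈ Finset.range n, ∑ j ∈ Finset.range n, φ (Y i ω) (Y j ω))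

lemma Vst_mono {Ω E : Type*} (Y : ℕ → Ω → E) (φ ψ : E → E → ℝ) (hle : ∀ x y, φ x y ≤ ψ x y)
    (n : ℕ) (ω : Ω) : Vst Y φ n ω ≤ Vst Y ψ n ω := by
  unfold Vst
  gcongr
  exact hle _ _

lemma Vst_integrable {Ω E : Type*} [MeasurableSpace Ω] (μ : Measure Ω) (Y : ℕ → Ω → E)
    (φ : E → E → ℝ) (hi : ∀ i j, Integrable (fun ω => φ (Y i ω) (Y j ω)) μ) (n : ℕ) :
    Integrable (Vst Y φ n) μ := by
  unfold Vst
  exact ((integrable_finsetSum _ fun i _ => integrable_finsetSum _ fun j _ => hi i j).const_mul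
    _).const_mul _

lemma Vst_integrable_bdd {Ω E : Type*} [MeasurableSpace Ω] [MeasurableSpace E] (μ : Measure Ω)
    [IsProbabilityMeasure μ] (Y : ℕ → Ω → E) (hY : ∀ k, Measurable (Y k))
    (φ : E → E → ℝ) (hφ : Measurable (Function.uncurry φ)) (M : ℝ) (hM : ∀ x y, |φ x y| ≤ M) (n : ℕ) :
    Integrable (Vst Y φ n) μ := by
  refine Vst_integrable μ Y φ (fun i j => ?_) n
  refine Integrable.of_bound (C := M) ?_ (Eventually.of_forall fun ω => hM _ _)
  exact (hφ.comp ((hY i).prodMk (hY j))).aestronglyMeasurable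

lemma Vstat_bdd {Ω E : Type*} [MeasurableSpace Ω] [MeasurableSpace E] (μ : Measure Ω)
    [IsProbabilityMeasure μ] (F : Measure E) [IsProbabilityMeasure F]
    [TopologicalSpace E] [SecondCountableTopology E] [OpensMeasurableSpace E]
    (Y : ℕ → Ω → E) (hY : ∀ k, Measurable (Y k))
    (hLLN : ∀ A : Set E, MeasurableSet A → Tendsto (fun n : ℕ =>
      ∫ ω, |(n : ℝ)⁻¹ * ∑ k ∈ Finset.range n, A.indicator (fun _ => (1 : ℝ)) (Y k ω) - F.real A| ∂μ)
        atTop (𝓝 0))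
    (h : E → E → ℝ) (hmeas : Measurable (Function.uncurry h)) (M : ℝ) (hM : ∀ x y, |h x y| ≤ M)
    (hcont : ∀ᵐ p ∂(F.prod F), ContinuousAt (Function.uncurry h) p) :
    Tendsto (fun n : ℕ => ∫ ω, |Vst Y h n ω - ∫ p, h p.1 p.2 ∂(F.prod F)| ∂μ) atTop (𝓝 0) := by
  classical
  have : Nonempty E := nonempty_of_isProbabilityMeasure F
  obtain ⟨b, hbc, -, hb⟩ := TopologicalSpace.exists_countable_basis E
  have hbne : b.Nonempty := by
    obtain ⟨x⟩ := ‹Nonempty E›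
    obtain ⟨v, hv, -⟩ := hb.exists_subset_of_mem_open (Set.mem_univ x) isOpen_univ
    exact ⟨v, hv⟩
  obtain ⟨B, rfl⟩ := hbc.exists_eq_range hbne
  have hBo : ∀ i, IsOpen (B i) := fun i => hb.isOpen ⟨i, rfl⟩
  set q : ∀ k : ℕ, E → (Fin k → Prop) := fun k x i => x ∈ B i with hqdef
  have hq : ∀ k, Measurable (q k) := by
    intro k
    refine measurable_pi_iff.2 fun i => ?_
    exact measurable_mem.2 (hBo i).measurableSet
  set C : ∀ k : ℕ, (Fin k → Prop) → (Fin k → Prop) → Set ℝ := fun k u v =>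
    (fun p : E × E => h p.1 p.2) '' {p | q k p.1 = u ∧ q k p.2 = v} with hC
  have hCM : ∀ k u v, ∀ r ∈ C k u v, -M ≤ r ∧ r ≤ M := by
    rintro k u v r ⟨p, -, rfl⟩
    exact abs_le.1 (hM p.1 p.2)
  have hCa : ∀ k u v, BddAbove (C k u v) := fun k u v => ⟨M, fun r hr => (hCM k u v r hr).2⟩
  have hCb : ∀ k u v, BddBelow (C k u v) := fun k u v => ⟨-M, fun r hr => (hCM k u v r hr).1⟩
  have hCmem : ∀ k x y, h x y ∈ C k (q k x) (q k y) := fun k x y => ⟨(x, y), ⟨rfl, rfl⟩, rfl⟩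
  set U : ℕ → E → E → ℝ := fun k x y => sSup (C k (q k x) (q k y)) with hU
  set L : ℕ → E → E → ℝ := fun k x y => sInf (C k (q k x) (q k y)) with hL
  have hhU : ∀ k x y, h x y ≤ U k x y := fun k x y => le_csSup (hCa _ _ _) (hCmem k x y)
  have hLh : ∀ k x y, L k x y ≤ h x y := fun k x y => csInf_le (hCb _ _ _) (hCmem k x y)
  have hUM : ∀ k x y, |U k x y| ≤ M := fun k x y => abs_le.2
    ⟨(abs_le.1 (hM x y)).1.trans (hhU k x y),
      csSup_le ⟨_, hCmem k x y⟩ fun r hr => (hCM _ _ _ r hr).2⟩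
  have hLM : ∀ k x y, |L k x y| ≤ M := fun k x y => abs_le.2
    ⟨le_csInf ⟨_, hCmem k x y⟩ fun r hr => (hCM _ _ _ r hr).1,
      (hLh k x y).trans (abs_le.1 (hM x y)).2⟩
  have hq2 : ∀ k, Measurable (fun p : E × E => (q k p.1, q k p.2)) := fun k =>
    ((hq k).comp measurable_fst).prodMk ((hq k).comp measurable_snd)
  have hUm : ∀ k, Measurable (Function.uncurry (U k)) := fun k =>
    (measurable_of_countable (fun w : (Fin k → Prop) × (Fin k → Prop) => sSup (C k w.1 w.2))).comp
      (hq2 k)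
  have hLm : ∀ k, Measurable (Function.uncurry (L k)) := fun k =>
    (measurable_of_countable (fun w : (Fin k → Prop) × (Fin k → Prop) => sInf (C k w.1 w.2))).comp
      (hq2 k)
  have hnear : ∀ p : E × E, ContinuousAt (Function.uncurry h) p → ∀ ε > 0, ∀ᶠ k in atTop,
      ∀ r ∈ C k (q k p.1) (q k p.2), |r - h p.1 p.2| < ε := by
    rintro ⟨x, y⟩ hp ε hε
    have h1 : ∀ᶠ p' in 𝓝 (x, y), dist (Function.uncurry h p') (Function.uncurry h (x, y)) < ε :=
      hp.eventually (Metric.ball_mem_nhds _ hε)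
    rw [nhds_prod_eq] at h1
    obtain ⟨s, hs, t, ht, hst⟩ := Filter.mem_prod_iff.1 h1
    obtain ⟨_, ⟨i, rfl⟩, hxi, his⟩ := hb.mem_nhds_iff.1 hs
    obtain ⟨_, ⟨j, rfl⟩, hyj, hjt⟩ := hb.mem_nhds_iff.1 ht
    filter_upwards [eventually_gt_atTop i, eventually_gt_atTop j] with k hki hkj
    rintro r ⟨⟨x', y'⟩, ⟨hx', hy'⟩, rfl⟩
    have h2 : x' ∈ B i := by
      have := congrFun hx' ⟨i, hki⟩
      simp only [hqdef] at this
      rw [this]; exact hxi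
    have h3 : y' ∈ B j := by
      have := congrFun hy' ⟨j, hkj⟩
      simp only [hqdef] at this
      rw [this]; exact hyj
    exact hst (Set.mk_mem_prod (his h2) (hjt h3))
  have hUlim : ∀ p : E × E, ContinuousAt (Function.uncurry h) p →
      Tendsto (fun k => U k p.1 p.2) atTop (𝓝 (h p.1 p.2)) := by
    intro p hp
    rw [Metric.tendsto_nhds]
    intro ε hε
    filter_upwards [hnear p hp (ε / 2) (by positivity)] with k hk
    rw [Real.dist_eq, abs_lt]
    have h1 := hhU k p.1 p.2
    have h2 : U k p.1 p.2 ≤ h p.1 p.2 + ε / 2 := csSup_le ⟨_, hCmem k _ _⟩ fun r hr => by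
      have := (abs_lt.1 (hk r hr)).2; linarith
    constructor <;> linarith
  have hLlim : ∀ p : E × E, ContinuousAt (Function.uncurry h) p →
      Tendsto (fun k => L k p.1 p.2) atTop (𝓝 (h p.1 p.2)) := by
    intro p hp
    rw [Metric.tendsto_nhds]
    intro ε hε
    filter_upwards [hnear p hp (ε / 2) (by positivity)] with k hk
    rw [Real.dist_eq, abs_lt]
    have h1 := hLh k p.1 p.2
    have h2 : h p.1 p.2 - ε / 2 ≤ L k p.1 p.2 := le_csInf ⟨_, hCmem k _ _⟩ fun r hr => by
      have := (abs_lt.1 (hk r hr)).1; linarith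
    constructor <;> linarith
  have hUI : Tendsto (fun k => ∫ p, U k p.1 p.2 ∂(F.prod F)) atTop
      (𝓝 (∫ p, h p.1 p.2 ∂(F.prod F))) := by
    refine tendsto_integral_of_dominated_convergence (fun _ => M)
      (fun k => (hUm k).aestronglyMeasurable) (integrable_const _)
      (fun k => Eventually.of_forall fun p => hUM k p.1 p.2) ?_
    filter_upwards [hcont] with p hp using hUlim p hp
  have hLI : Tendsto (fun k => ∫ p, L k p.1 p.2 ∂(F.prod F)) atTop
      (𝓝 (∫ p, h p.1 p.2 ∂(F.prod F))) := by
    refine tendsto_integral_of_dominated_convergence (fun _ => M)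
      (fun k => (hLm k).aestronglyMeasurable) (integrable_const _)
      (fun k => Eventually.of_forall fun p => hLM k p.1 p.2) ?_
    filter_upwards [hcont] with p hp using hLlim p hp
  have hUint : ∀ k, Integrable (fun p : E × E => U k p.1 p.2) (F.prod F) := fun k =>
    Integrable.of_bound (hUm k).aestronglyMeasurable M (Eventually.of_forall fun p => hUM k p.1 p.2)
  have hLint : ∀ k, Integrable (fun p : E × E => L k p.1 p.2) (F.prod F) := fun k =>
    Integrable.of_bound (hLm k).aestronglyMeasurable M (Eventually.of_forall fun p => hLM k p.1 p.2)
  have hhint : Integrable (fun p : E × E => h p.1 p.2) (F.prod F) :=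
    Integrable.of_bound hmeas.aestronglyMeasurable M (Eventually.of_forall fun p => hM p.1 p.2)
  rw [Metric.tendsto_nhds]
  intro ε hε
  have hd : Tendsto (fun k => ∫ p, U k p.1 p.2 ∂(F.prod F) - ∫ p, L k p.1 p.2 ∂(F.prod F)) atTop
      (𝓝 0) := by simpa using hUI.sub hLI
  obtain ⟨k, hk⟩ := (hd.eventually_lt_const (by positivity : (0 : ℝ) < ε / 3)).exists
  have hu := Vstat_cell μ F Y hY hLLN (q k) (hq k) (fun u v => sSup (C k u v))
  have hl := Vstat_cell μ F Y hY hLLN (q k) (hq k) (fun u v => sInf (C k u v))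
  filter_upwards [hu.eventually_lt_const (by positivity : (0 : ℝ) < ε / 3),
    hl.eventually_lt_const (by positivity : (0 : ℝ) < ε / 3)] with n hun hln
  change ∫ ω, |Vst Y (U k) n ω - ∫ p, U k p.1 p.2 ∂(F.prod F)| ∂μ < ε / 3 at hun
  change ∫ ω, |Vst Y (L k) n ω - ∫ p, L k p.1 p.2 ∂(F.prod F)| ∂μ < ε / 3 at hln
  rw [Real.dist_eq, sub_zero, abs_of_nonneg (integral_nonneg fun _ => abs_nonneg _)]
  set cU := ∫ p, U k p.1 p.2 ∂(F.prod F)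
  set cL := ∫ p, L k p.1 p.2 ∂(F.prod F)
  have hcU : ∫ p, h p.1 p.2 ∂(F.prod F) ≤ cU := integral_mono hhint (hUint k) fun p => hhU k _ _
  have hcL : cL ≤ ∫ p, h p.1 p.2 ∂(F.prod F) := integral_mono (hLint k) hhint fun p => hLh k _ _
  set c := ∫ p, h p.1 p.2 ∂(F.prod F)
  have i1 : Integrable (fun ω => |Vst Y (U k) n ω - cU|) μ :=
    ((Vst_integrable_bdd μ Y hY (U k) (hUm k) M (hUM k) n).sub (integrable_const _)).abs
  have i2 : Integrable (fun ω => |Vst Y (L k) n ω - cL|) μ :=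
    ((Vst_integrable_bdd μ Y hY (L k) (hLm k) M (hLM k) n).sub (integrable_const _)).abs
  have : ∫ ω, |Vst Y h n ω - c| ∂μ ≤
      ∫ ω, (|Vst Y (U k) n ω - cU| + |Vst Y (L k) n ω - cL| + (cU - cL)) ∂μ := by
    refine integral_mono_of_nonneg (Eventually.of_forall fun _ => abs_nonneg _)
      ((i1.add i2).add (integrable_const _)) (Eventually.of_forall fun ω => ?_)
    have v1 := Vst_mono Y _ _ (hhU k) n ω
    have v2 := Vst_mono Y _ _ (hLh k) n ω
    have a1 := abs_le.1 (le_refl |Vst Y (U k) n ω - cU|)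
    have a2 := abs_le.1 (le_refl |Vst Y (L k) n ω - cL|)
    refine abs_le.2 ⟨?_, ?_⟩ <;> linarith [abs_nonneg (Vst Y (U k) n ω - cU), abs_nonneg (Vst Y (L k) n ω - cL)]
  have i12 : Integrable (fun ω => |Vst Y (U k) n ω - cU| + |Vst Y (L k) n ω - cL|) μ := i1.add i2
  rw [integral_add i12 (integrable_const _), integral_add i1 i2] at this
  simp at this
  linarith

lemma sum_square_symm (a : ℕ → ℕ → ℝ) (ha : ∀ i j, a i j = a j i) (n : ℕ) :
    ∑ i ∈ Finset.range n, ∑ j ∈ Finset.range n, a i j =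
      2 * ∑ j ∈ Finset.range n, ∑ i ∈ Finset.range j, a i j + ∑ i ∈ Finset.range n, a i i := by
  induction n with
  | zero => simp
  | succ n ih =>
    simp only [Finset.sum_range_succ, Finset.sum_add_distrib] at *
    rw [ih]
    have : ∑ j ∈ Finset.range n, a n j = ∑ i ∈ Finset.range n, a i n :=
      Finset.sum_congr rfl fun i _ => ha _ _
    rw [this]; ring

lemma cast_choose_two_sum (n : ℕ) : ∑ j ∈ Finset.range n, (j : ℝ) = (n.choose 2 : ℝ) := by
  rw [← Nat.cast_sum, Finset.sum_range_id, Nat.choose_two_right]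

/-- The U-statistic. -/
noncomputable def Ust {Ω E : Type*} (Y : ℕ → Ω → E) (φ : E → E → ℝ) (n : ℕ) (ω : Ω) : ℝ :=
  (n.choose 2 : ℝ)⁻¹ * ∑ j ∈ Finset.range n, ∑ i ∈ Finset.range j, φ (Y i ω) (Y j ω)

lemma Ust_sub_Vst {Ω E : Type*} (Y : ℕ → Ω → E) (φ : E → E → ℝ) (hsymm : ∀ x y, φ x y = φ y x)
    (M : ℝ) (hM : ∀ x y, |φ x y| ≤ M) (n : ℕ) (hn : 2 ≤ n) (ω : Ω) :
    |Ust Y φ n ω - Vst Y φ n ω| ≤ 2 * M / n := by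
  have hM0 : 0 ≤ M := (abs_nonneg _).trans (hM (Y 0 ω) (Y 0 ω))
  have hn0 : (0 : ℝ) < n := by positivity
  have hch : (n.choose 2 : ℝ) = n * (n - 1) / 2 := Nat.cast_choose_two ℝ n
  have hn1 : (0 : ℝ) < n - 1 := by
    have : (2 : ℝ) ≤ n := by exact_mod_cast hn
    linarith
  have hch0 : (0 : ℝ) < n.choose 2 := by rw [hch]; positivity
  set S := ∑ j ∈ Finset.range n, ∑ i ∈ Finset.range j, φ (Y i ω) (Y j ω) with hS
  set D := ∑ i ∈ Finset.range n, φ (Y i ω) (Y i ω) with hD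
  have hDb : |D| ≤ n * M := by
    refine (Finset.abs_sum_le_sum_abs _ _).trans ((Finset.sum_le_sum fun i _ => hM _ _).trans ?_)
    simp
  have hSb : |S| ≤ n.choose 2 * M := by
    rw [← cast_choose_two_sum, Finset.sum_mul]
    refine (Finset.abs_sum_le_sum_abs _ _).trans (Finset.sum_le_sum fun j _ => ?_)
    refine (Finset.abs_sum_le_sum_abs _ _).trans ((Finset.sum_le_sum fun i _ => hM _ _).trans ?_)
    simp
  have hUb : |Ust Y φ n ω| ≤ M := by
    unfold Ust
    rw [abs_mul, abs_inv, abs_of_pos hch0, inv_mul_le_iff₀ hch0]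
    exact hSb
  have hV : Ust Y φ n ω - Vst Y φ n ω = Ust Y φ n ω / n - D / n / n := by
    have e : Vst Y φ n ω = (n : ℝ)⁻¹ * ((n : ℝ)⁻¹ * (2 * S + D)) := by
      unfold Vst
      rw [sum_square_symm (fun i j => φ (Y i ω) (Y j ω)) (fun i j => hsymm _ _)]
    have e2 : S = n * (n - 1) / 2 * Ust Y φ n ω := by
      unfold Ust
      rw [← hch, mul_inv_cancel_left₀ hch0.ne']
    rw [e, e2]
    field_simp
    ring
  rw [hV]
  refine (abs_sub _ _).trans ?_
  have h1 : |Ust Y φ n ω / n| ≤ M / n := by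
    rw [abs_div, abs_of_pos hn0]; gcongr
  have h2 : |D / n / n| ≤ M / n := by
    rw [abs_div, abs_div, abs_of_pos hn0]
    gcongr
    rw [div_le_iff₀ hn0]; linarith
  calc _ ≤ M / n + M / n := add_le_add h1 h2
    _ = _ := by ring

/-- Truncation at level `M`. -/
noncomputable def clampR (M t : ℝ) : ℝ := max (-M) (min t M)

lemma clampR_abs_le (M t : ℝ) (hM : 0 ≤ M) : |clampR M t| ≤ M := by
  unfold clampR
  rw [abs_le]
  exact ⟨le_max_left _ _, max_le (by linarith) (min_le_right _ _)⟩

lemma clampR_continuous (M : ℝ) : Continuous (clampR M) := by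
  unfold clampR; fun_prop

lemma clampR_eq (M t : ℝ) (h : |t| ≤ M) : clampR M t = t := by
  unfold clampR
  rw [abs_le] at h
  rw [min_eq_left h.2, max_eq_right h.1]

lemma clampR_sub_le (M t : ℝ) (hM : 0 ≤ M) : |t - clampR M t| ≤ |t| := by
  rcases le_or_gt |t| M with h | h
  · rw [clampR_eq M t h]; simp
  · unfold clampR
    rcases abs_cases t with ⟨h1, h2⟩ | ⟨h1, h2⟩
    · rw [min_eq_right (by linarith), max_eq_right (by linarith), abs_le]
      constructor <;> linarith
    · rw [min_eq_left (by linarith), max_eq_left (by linarith), abs_le]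
      constructor <;> linarith

lemma Ust_final {Ω E : Type*} [MeasurableSpace Ω] [MeasurableSpace E] (μ : Measure Ω)
    [IsProbabilityMeasure μ] (F : Measure E) [IsProbabilityMeasure F]
    [TopologicalSpace E] [SecondCountableTopology E] [OpensMeasurableSpace E]
    (Y : ℕ → Ω → E) (hY : ∀ k, Measurable (Y k))
    (hLLN : ∀ A : Set E, MeasurableSet A → Tendsto (fun n : ℕ =>
      ∫ ω, |(n : ℝ)⁻¹ * ∑ k ∈ Finset.range n, A.indicator (fun _ => (1 : ℝ)) (Y k ω) - F.real A| ∂μ)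
        atTop (𝓝 0))
    (hstat : ∀ i m, μ.map (fun ω => (Y i ω, Y (i + m) ω)) = μ.map (fun ω => (Y 0 ω, Y m ω)))
    (h : E → E → ℝ) (hmeas : Measurable (Function.uncurry h))
    (hsymm : ∀ x y, h x y = h y x)
    (hcont : ∀ᵐ p ∂(F.prod F), ContinuousAt (Function.uncurry h) p)
    (hint : ∀ j, Integrable (fun ω => h (Y 0 ω) (Y j ω)) μ)
    (hUI : ∀ ε : ℝ, 0 < ε → ∃ M : ℝ, ∀ j,
      ∫ ω in {ω | M < |h (Y 0 ω) (Y j ω)|}, |h (Y 0 ω) (Y j ω)| ∂μ ≤ ε) :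
    Tendsto (fun n : ℕ => ∫ ω, |Ust Y h n ω - ∫ p, h p.1 p.2 ∂(F.prod F)| ∂μ) atTop (𝓝 0) := by
  have hpm : ∀ i j, Measurable (fun ω => (Y i ω, Y j ω)) := fun i j => (hY i).prodMk (hY j)
  -- stationarity
  have hid : ∀ g : E → E → ℝ, Measurable (Function.uncurry g) → (∀ x y, g x y = g y x) →
      ∀ i j, ∃ m, ProbabilityTheory.IdentDistrib (fun ω => g (Y i ω) (Y j ω))
        (fun ω => g (Y 0 ω) (Y m ω)) μ μ := by
    intro g hg hgs i j
    have key : ∀ i m, ProbabilityTheory.IdentDistrib (fun ω => g (Y i ω) (Y (i + m) ω))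
        (fun ω => g (Y 0 ω) (Y m ω)) μ μ := by
      intro i m
      have : ProbabilityTheory.IdentDistrib (fun ω => (Y i ω, Y (i + m) ω))
        (fun ω => (Y 0 ω, Y m ω)) μ μ := ⟨(hpm _ _).aemeasurable, (hpm _ _).aemeasurable, hstat i m⟩
      exact this.comp hg
    rcases le_total i j with hij | hij
    · obtain ⟨m, rfl⟩ := Nat.exists_eq_add_of_le hij
      exact ⟨m, key i m⟩
    · obtain ⟨m, rfl⟩ := Nat.exists_eq_add_of_le hij
      refine ⟨m, ?_⟩
      have := key j m
      simp only [hgs (Y j _)] at this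
      exact this
  have hint2 : ∀ i j, Integrable (fun ω => h (Y i ω) (Y j ω)) μ := by
    intro i j
    obtain ⟨m, hm⟩ := hid h hmeas hsymm i j
    exact hm.integrable_iff.2 (hint m)
  have hsetm : ∀ M j, MeasurableSet {ω | M < |h (Y 0 ω) (Y j ω)|} := fun M j =>
    measurableSet_lt measurable_const (hmeas.comp (hpm 0 j)).abs
  -- uniform integrability for truncations
  have htail : ∀ ε : ℝ, 0 < ε → ∃ M : ℝ, ∀ M', M ≤ M' → 0 ≤ M' → ∀ i j,
      ∫ ω, |h (Y i ω) (Y j ω) - clampR M' (h (Y i ω) (Y j ω))| ∂μ ≤ ε := by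
    intro ε hε
    obtain ⟨M, hM⟩ := hUI ε hε
    refine ⟨M, fun M' hMM hM0 i j => ?_⟩
    obtain ⟨m, hm⟩ := hid (fun x y => |h x y - clampR M' (h x y)|)
      ((hmeas.sub ((clampR_continuous M').measurable.comp hmeas)).abs)
      (fun x y => by rw [hsymm]) i j
    rw [hm.integral_eq]
    refine le_trans ?_ (hM m)
    rw [← integral_indicator (hsetm M m)]
    refine integral_mono_of_nonneg (Eventually.of_forall fun _ => abs_nonneg _)
      ((hint m).abs.indicator (hsetm M m)) (Eventually.of_forall fun ω => ?_)
    simp only [Set.indicator_apply, Set.mem_ofPred_eq]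
    split_ifs with hlt
    · exact clampR_sub_le _ _ hM0
    · rw [clampR_eq _ _ (by linarith)]; simp
  have htrint : ∀ M : ℝ, 0 ≤ M → ∀ i j,
      Integrable (fun ω => |h (Y i ω) (Y j ω) - clampR M (h (Y i ω) (Y j ω))|) μ := by
    intro M hM0 i j
    refine (hint2 i j).abs.mono' (((hmeas.sub ((clampR_continuous M).measurable.comp
        hmeas)).abs.comp (hpm i j)).aestronglyMeasurable) (Eventually.of_forall fun ω => ?_)
    rw [Real.norm_eq_abs, abs_abs]
    exact clampR_sub_le _ _ hM0
  obtain ⟨C, hC0, hC⟩ : ∃ C : ℝ, 0 ≤ C ∧ ∀ i j, ∫ ω, |h (Y i ω) (Y j ω)| ∂μ ≤ C := by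
    obtain ⟨M, hM⟩ := htail 1 one_pos
    have hM0 : 0 ≤ max M 0 := le_max_right _ _
    refine ⟨max M 0 + 1, by linarith, fun i j => ?_⟩
    have h1 := hM (max M 0) (le_max_left _ _) hM0 i j
    have i1 := htrint (max M 0) hM0 i j
    calc ∫ ω, |h (Y i ω) (Y j ω)| ∂μ
        ≤ ∫ ω, (max M 0 + |h (Y i ω) (Y j ω) - clampR (max M 0) (h (Y i ω) (Y j ω))|) ∂μ := by
          refine integral_mono (hint2 i j).abs ((integrable_const _).add i1) fun ω => ?_
          have := clampR_abs_le (max M 0) (h (Y i ω) (Y j ω)) hM0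
          have h3 := abs_add_le (clampR (max M 0) (h (Y i ω) (Y j ω)))
            (h (Y i ω) (Y j ω) - clampR (max M 0) (h (Y i ω) (Y j ω)))
          simp only [add_sub_cancel] at h3
          linarith
      _ = max M 0 + ∫ ω, |h (Y i ω) (Y j ω) - clampR (max M 0) (h (Y i ω) (Y j ω))| ∂μ := by
          rw [integral_add (integrable_const _) i1]; simp
      _ ≤ _ := by linarith
  -- truncated absolute values have integral at most `C`
  have hminC : ∀ k : ℕ, ∫ p, min |h p.1 p.2| (k : ℝ) ∂(F.prod F) ≤ C := by
    intro k
    have hk0 : (0 : ℝ) ≤ k := by positivity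
    have hgm : Measurable (Function.uncurry fun x y => min |h x y| (k : ℝ)) :=
      hmeas.abs.min measurable_const
    have hgb : ∀ x y, |min |h x y| (k : ℝ)| ≤ k := fun x y => by
      rw [abs_of_nonneg (le_min (abs_nonneg _) hk0)]; exact min_le_right _ _
    have hlim := Vstat_bdd μ F Y hY hLLN (fun x y => min |h x y| (k : ℝ)) hgm k hgb (by
        filter_upwards [hcont] with p hp
        exact hp.abs.min continuousAt_const)
    set c := ∫ p, min |h p.1 p.2| (k : ℝ) ∂(F.prod F)
    have hEV : ∀ n, ∫ ω, Vst Y (fun x y => min |h x y| (k : ℝ)) n ω ∂μ ≤ C := by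
      intro n
      have hi : ∀ i j, Integrable (fun ω => min |h (Y i ω) (Y j ω)| (k : ℝ)) μ := fun i j =>
        Integrable.of_bound ((hgm.comp (hpm i j)).aestronglyMeasurable) k
          (Eventually.of_forall fun ω => hgb _ _)
      have hb : ∀ i j, ∫ ω, min |h (Y i ω) (Y j ω)| (k : ℝ) ∂μ ≤ C := fun i j =>
        (integral_mono (hi i j) (hint2 i j).abs fun ω => min_le_left _ _).trans (hC i j)
      unfold Vst
      rw [integral_const_mul, integral_const_mul,
        integral_finsetSum _ (fun i _ => integrable_finsetSum _ fun j _ => hi i j)]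
      have : ∑ i ∈ Finset.range n, ∫ ω, ∑ j ∈ Finset.range n, min |h (Y i ω) (Y j ω)| (k : ℝ) ∂μ
          ≤ n * (n * C) := by
        calc _ ≤ ∑ i ∈ Finset.range n, ((n : ℝ) * C) := by
              refine Finset.sum_le_sum fun i _ => ?_
              rw [integral_finsetSum _ (fun j _ => hi i j)]
              refine (Finset.sum_le_sum fun j _ => hb i j).trans ?_
              simp
          _ = _ := by simp
      rcases Nat.eq_zero_or_pos n with h0 | h0
      · simpa [h0] using hC0
      · have hn0 : (0 : ℝ) < n := by positivity
        rw [inv_mul_le_iff₀ hn0, inv_mul_le_iff₀ hn0]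
        exact this
    have hle : ∀ n, c - C ≤ ∫ ω, |Vst Y (fun x y => min |h x y| (k : ℝ)) n ω - c| ∂μ := by
      intro n
      have hVi := Vst_integrable_bdd μ Y hY _ hgm k hgb n
      have e : ∫ ω, (c - Vst Y (fun x y => min |h x y| (k : ℝ)) n ω) ∂μ =
          c - ∫ ω, Vst Y (fun x y => min |h x y| (k : ℝ)) n ω ∂μ := by
        rw [integral_sub (integrable_const _) hVi]; simp
      have e2 : ∫ ω, (c - Vst Y (fun x y => min |h x y| (k : ℝ)) n ω) ∂μ ≤
          ∫ ω, |Vst Y (fun x y => min |h x y| (k : ℝ)) n ω - c| ∂μ := by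
        refine integral_mono ((integrable_const _).sub hVi)
          (hVi.sub (integrable_const _)).abs fun ω => ?_
        have := neg_abs_le (Vst Y (fun x y => min |h x y| (k : ℝ)) n ω - c)
        simp only
        linarith
      linarith [hEV n]
    have := ge_of_tendsto' hlim hle
    linarith
  have hFint : Integrable (fun p : E × E => h p.1 p.2) (F.prod F) := by
    refine ⟨hmeas.aestronglyMeasurable, ?_⟩
    have hle : ∫⁻ p, ENNReal.ofReal |h p.1 p.2| ∂(F.prod F) ≤ ENNReal.ofReal C := by
      have hm1 : ∀ k : ℕ, Measurable (fun p : E × E => min |h p.1 p.2| (k : ℝ)) := fun k =>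
        hmeas.abs.min measurable_const
      have ht := lintegral_tendsto_of_tendsto_of_monotone (μ := F.prod F)
        (f := fun (k : ℕ) p => ENNReal.ofReal (min |h p.1 p.2| (k : ℝ)))
        (F := fun p => ENNReal.ofReal |h p.1 p.2|)
        (fun k => (hm1 k).ennreal_ofReal.aemeasurable)
        (Eventually.of_forall fun p k l hkl => by
          simp only
          gcongr)
        (Eventually.of_forall fun p => by
          refine (ENNReal.continuous_ofReal.tendsto _).comp (tendsto_const_nhds.congr' ?_)
          obtain ⟨K, hK⟩ := exists_nat_ge |h p.1 p.2|
          filter_upwards [eventually_ge_atTop K] with k hk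
          have : (K : ℝ) ≤ k := by exact_mod_cast hk
          rw [min_eq_left (hK.trans this)])
      refine le_of_tendsto' ht fun k => ?_
      rw [← ofReal_integral_eq_lintegral_ofReal]
      · exact ENNReal.ofReal_le_ofReal (hminC k)
      · refine Integrable.of_bound (hm1 k).aestronglyMeasurable k (Eventually.of_forall fun p => ?_)
        rw [Real.norm_eq_abs, abs_of_nonneg (le_min (abs_nonneg _) (by positivity))]
        exact min_le_right _ _
      · exact Eventually.of_forall fun p => le_min (abs_nonneg _) (by positivity)
    rw [hasFiniteIntegral_iff_norm]
    exact hle.trans_lt ENNReal.ofReal_lt_top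
  have hFtail : Tendsto (fun k : ℕ => ∫ p, clampR k (h p.1 p.2) ∂(F.prod F)) atTop
      (𝓝 (∫ p, h p.1 p.2 ∂(F.prod F))) := by
    refine tendsto_integral_of_dominated_convergence (fun p => 2 * |h p.1 p.2|)
      (fun k => ((clampR_continuous k).measurable.comp hmeas).aestronglyMeasurable)
      (hFint.abs.const_mul 2)
      (fun k => Eventually.of_forall fun p => ?_) (Eventually.of_forall fun p => ?_)
    · have h1 := clampR_sub_le k (h p.1 p.2) (by positivity)
      have h2 := abs_sub_abs_le_abs_sub (clampR k (h p.1 p.2)) (h p.1 p.2)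
      rw [abs_sub_comm] at h2
      rw [Real.norm_eq_abs]
      linarith
    · refine tendsto_const_nhds.congr' ?_
      obtain ⟨K, hK⟩ := exists_nat_ge |h p.1 p.2|
      filter_upwards [eventually_ge_atTop K] with k hk
      have : (K : ℝ) ≤ k := by exact_mod_cast hk
      rw [clampR_eq _ _ (hK.trans this)]
  -- conclusion
  rw [Metric.tendsto_nhds]
  intro ε hε
  obtain ⟨M, hM⟩ := htail (ε / 5) (by positivity)
  obtain ⟨K, hK⟩ := exists_nat_ge M
  obtain ⟨k, hk1, hk2⟩ := ((Metric.tendsto_nhds.1 hFtail (ε / 5) (by positivity)).and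
    (eventually_ge_atTop K)).exists
  have hk0 : (0 : ℝ) ≤ k := by positivity
  have hMk : M ≤ k := hK.trans (by exact_mod_cast hk2)
  have htl := hM k hMk hk0
  set g : E → E → ℝ := fun x y => clampR k (h x y) with hg
  have hgm : Measurable (Function.uncurry g) := (clampR_continuous k).measurable.comp hmeas
  have hgb : ∀ x y, |g x y| ≤ k := fun x y => clampR_abs_le _ _ hk0
  have hgs : ∀ x y, g x y = g y x := fun x y => by simp only [hg]; rw [hsymm]
  have hV := Vstat_bdd μ F Y hY hLLN g hgm k hgb (by
    filter_upwards [hcont] with p hp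
    exact (clampR_continuous k).continuousAt.comp hp)
  have h2k : Tendsto (fun n : ℕ => 2 * (k : ℝ) / n) atTop (𝓝 0) :=
    tendsto_const_div_atTop_nhds_zero_nat _
  rw [Real.dist_eq] at hk1
  change |∫ p, g p.1 p.2 ∂(F.prod F) - _| < _ at hk1
  set cg := ∫ p, g p.1 p.2 ∂(F.prod F)
  set c := ∫ p, h p.1 p.2 ∂(F.prod F)
  filter_upwards [hV.eventually_lt_const (by positivity : (0 : ℝ) < ε / 5),
    h2k.eventually_lt_const (by positivity : (0 : ℝ) < ε / 5), eventually_ge_atTop 2]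
    with n hn1 hn2 hn3
  rw [Real.dist_eq, sub_zero, abs_of_nonneg (integral_nonneg fun _ => abs_nonneg _)]
  have hch0 : (0 : ℝ) < n.choose 2 := by exact_mod_cast Nat.choose_pos hn3
  set R : Ω → ℝ := Ust Y (fun x y => |h x y - g x y|) n with hR
  have hri : ∀ i j, Integrable (fun ω => |h (Y i ω) (Y j ω) - g (Y i ω) (Y j ω)|) μ :=
    htrint k hk0
  have hRi : Integrable R μ := by
    simp only [hR]
    unfold Ust
    exact (integrable_finsetSum _ fun j _ => integrable_finsetSum _ fun i _ => hri i j).const_mul _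
  have hRE : ∫ ω, R ω ∂μ ≤ ε / 5 := by
    simp only [hR]
    unfold Ust
    rw [integral_const_mul,
      integral_finsetSum _ (fun j _ => integrable_finsetSum _ fun i _ => hri i j),
      inv_mul_le_iff₀ hch0, ← cast_choose_two_sum, Finset.sum_mul]
    refine Finset.sum_le_sum fun j _ => ?_
    rw [integral_finsetSum _ (fun i _ => hri i j)]
    refine (Finset.sum_le_sum fun i _ => htl i j).trans ?_
    simp
  have hRle : ∀ ω, |Ust Y h n ω - Ust Y g n ω| ≤ R ω := by
    intro ω
    simp only [hR]
    unfold Ust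
    rw [← mul_sub, abs_mul, abs_inv, abs_of_pos hch0, ← Finset.sum_sub_distrib]
    gcongr
    refine (Finset.abs_sum_le_sum_abs _ _).trans (Finset.sum_le_sum fun j _ => ?_)
    rw [← Finset.sum_sub_distrib]
    exact Finset.abs_sum_le_sum_abs _ _
  have hVi : Integrable (fun ω => |Vst Y g n ω - cg|) μ :=
    ((Vst_integrable_bdd μ Y hY g hgm k hgb n).sub (integrable_const _)).abs
  have hsum : Integrable (fun ω => R ω + |Vst Y g n ω - cg|) μ := hRi.add hVi
  have hfin : ∫ ω, |Ust Y h n ω - c| ∂μ ≤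
      ∫ ω, (R ω + |Vst Y g n ω - cg| + (2 * k / n + |cg - c|)) ∂μ := by
    refine integral_mono_of_nonneg (Eventually.of_forall fun _ => abs_nonneg _)
      (hsum.add (integrable_const _)) (Eventually.of_forall fun ω => ?_)
    have h1 := hRle ω
    have h2 := Ust_sub_Vst Y g hgs k hgb n hn3 ω
    have t1 := abs_sub_le (Ust Y h n ω) (Ust Y g n ω) c
    have t2 := abs_sub_le (Ust Y g n ω) (Vst Y g n ω) c
    have t3 := abs_sub_le (Vst Y g n ω) cg c
    simp only
    linarith
  rw [integral_add hsum (integrable_const _), integral_add hRi hVi] at hfin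
  simp at hfin
  linarith

/-- `L¹` convergence of the U-statistic for a stationary ergodic `ℝ^d`-valued sequence,
for a measurable symmetric kernel that is `F × F`-a.e. continuous, assuming the family
`{h(X_1, X_j) : j ≥ 1}` is uniformly integrable. Stationarity and ergodicity of
`(X_i)_{i ≥ 1}` are encoded by requiring that the law of the path `(X_1, X_2, …)` is
invariant and ergodic under the one-sided shift. -/
theorem stmt1 {Ω : Type*} [MeasurableSpace Ω] (μ : Measure Ω) [IsProbabilityMeasure μ]
    (d : ℕ) (X : ℕ → Ω → (Fin d → ℝ)) (hXmeas : ∀ k, Measurable (X k))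
    (hX : Ergodic (fun u : ℕ → (Fin d → ℝ) => fun n => u (n + 1))
      (Measure.map (fun ω => fun n => X (n + 1) ω) μ))
    (F : Measure (Fin d → ℝ)) (hF : F = Measure.map (X 1) μ)
    (h : (Fin d → ℝ) → (Fin d → ℝ) → ℝ)
    (hmeas : Measurable (Function.uncurry h))
    (hsymm : ∀ x y, h x y = h y x)
    (hcont : ∀ᵐ p ∂(F.prod F), ContinuousAt (Function.uncurry h) p)
    (hint : ∀ j, 1 ≤ j → Integrable (fun ω => h (X 1 ω) (X j ω)) μ)
    (hUI : ∀ ε : ℝ, 0 < ε → ∃ M : ℝ, ∀ j, 1 ≤ j →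
      ∫ ω in {ω | M < |h (X 1 ω) (X j ω)|}, |h (X 1 ω) (X j ω)| ∂μ ≤ ε) :
    Tendsto (fun n : ℕ => ∫ ω,
        |(n.choose 2 : ℝ)⁻¹ *
            (∑ j ∈ Finset.Icc 1 n, ∑ i ∈ Finset.Ico 1 j, h (X i ω) (X j ω))
          - ∫ p, h p.1 p.2 ∂(F.prod F)| ∂μ)
      atTop (𝓝 0) := by
  have hYm : ∀ k, Measurable (fun ω => X (k + 1) ω) := fun k => hXmeas _
  set path : Ω → ℕ → (Fin d → ℝ) := fun ω n => X (n + 1) ω with hpath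
  have hpm : Measurable path := measurable_pi_iff.2 fun k => hXmeas _
  set T : (ℕ → (Fin d → ℝ)) → ℕ → (Fin d → ℝ) := fun u n => u (n + 1) with hT
  have hTit : ∀ k u n, T^[k] u n = u (n + k) := by
    intro k
    induction k with
    | zero => intro u n; rfl
    | succ k ih =>
      intro u n
      rw [Function.iterate_succ_apply, ih]
      simp only [hT]
      congr 1
  have : IsProbabilityMeasure (μ.map path) := Measure.isProbabilityMeasure_map hpm.aemeasurable
  have hFp : IsProbabilityMeasure F := by
    rw [hF]; exact Measure.isProbabilityMeasure_map (hXmeas 1).aemeasurable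
  have hLLN : ∀ A : Set (Fin d → ℝ), MeasurableSet A → Tendsto (fun n : ℕ =>
      ∫ ω, |(n : ℝ)⁻¹ * ∑ k ∈ Finset.range n, A.indicator (fun _ => (1 : ℝ)) (X (k + 1) ω)
        - F.real A| ∂μ) atTop (𝓝 0) := by
    intro A hA
    have hfm : Measurable (fun u : ℕ → (Fin d → ℝ) => A.indicator (fun _ => (1 : ℝ)) (u 0)) :=
      (measurable_const.indicator hA).comp (measurable_pi_apply 0)
    have hf : MemLp (fun u : ℕ → (Fin d → ℝ) => A.indicator (fun _ => (1 : ℝ)) (u 0)) 2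
        (μ.map path) := by
      refine MemLp.of_bound hfm.aestronglyMeasurable 1 (Eventually.of_forall fun u => ?_)
      rw [Real.norm_eq_abs, abs_of_nonneg (Set.indicator_nonneg (fun _ _ => zero_le_one) _)]
      exact Set.indicator_le_self' (fun _ _ => zero_le_one) _
    have hlim := mean_ergodic_L1 (μ.map path) T hX _ hf
    have hc : ∫ u, A.indicator (fun _ => (1 : ℝ)) (u 0) ∂(μ.map path) = F.real A := by
      rw [integral_map hpm.aemeasurable hfm.aestronglyMeasurable]
      have : ∫ x, A.indicator (fun _ => (1 : ℝ)) x ∂F = F.real A := by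
        rw [integral_indicator hA]; simp
      rw [← this, hF, integral_map (hXmeas 1).aemeasurable
        (measurable_const.indicator hA).aestronglyMeasurable]
    rw [hc] at hlim
    refine hlim.congr fun n => ?_
    rw [integral_map hpm.aemeasurable]
    · simp only [hTit, hpath, zero_add]
    · have : ∀ k, Measurable (T^[k]) := fun k => hX.measurable.iterate k
      exact (((Finset.measurable_fun_sum _ fun k _ => hfm.comp (this k)).const_mul _).sub_const
        _).abs.aestronglyMeasurable
  have hstat : ∀ i m, μ.map (fun ω => (X (i + 1) ω, X (i + m + 1) ω)) =
      μ.map (fun ω => (X (0 + 1) ω, X (m + 1) ω)) := by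
    intro i m
    have hev : Measurable (fun u : ℕ → (Fin d → ℝ) => (u 0, u m)) :=
      (measurable_pi_apply 0).prodMk (measurable_pi_apply m)
    have hmp := hX.toMeasurePreserving.iterate i
    have e1 : μ.map (fun ω => (X (0 + 1) ω, X (m + 1) ω)) =
        (μ.map path).map (fun u => (u 0, u m)) := by
      rw [Measure.map_map hev hpm]; rfl
    rw [e1, ← hmp.map_eq, Measure.map_map hev hmp.measurable,
      Measure.map_map (hev.comp hmp.measurable) hpm]
    congr 1
    funext ω
    simp only [Function.comp]
    rw [hTit, hTit]
    simp only [hpath, zero_add, add_comm m i]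
  have key := Ust_final μ F (fun k ω => X (k + 1) ω) hYm hLLN hstat h hmeas hsymm hcont
    (fun j => hint (j + 1) (by omega)) (fun ε hε => by
      obtain ⟨M, hM⟩ := hUI ε hε
      exact ⟨M, fun j => hM (j + 1) (by omega)⟩)
  refine key.congr fun n => ?_
  unfold Ust
  have hre : ∀ ω, ∑ j ∈ Finset.Icc 1 n, ∑ i ∈ Finset.Ico 1 j, h (X i ω) (X j ω) =
      ∑ j ∈ Finset.range n, ∑ i ∈ Finset.range j, h (X (i + 1) ω) (X (j + 1) ω) := by
    intro ω
    have e : Finset.Icc 1 n = Finset.Ico 1 (n + 1) := by ext; simp only [Finset.mem_Icc, Finset.mem_Ico]; omega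
    rw [e, Finset.sum_Ico_eq_sum_range]
    refine Finset.sum_congr (by simp) fun j _ => ?_
    rw [Finset.sum_Ico_eq_sum_range]
    refine Finset.sum_congr (by simp) fun i _ => ?_
    rw [add_comm 1 i, add_comm 1 j]
  simp only [hre]
end

section
/- Let (X_i)_{i≥0} be a stationary ergodic sequence taking values in ℝ^d with marginal distribution F, and let h : ℝ^d × ℝ^d → ℝ be a measurable function such that the family {h(X_1, X_j) : j ≥ 1} is uniformly integrable and ∬ |h(x,y)| dF(x) dF(y) < ∞. Assume X_0 has a bounded density with respect to Lebesgue measure on ℝ^d, and for each k ≥ 1 the vector (X_0, X_k) has a density f_k with respect to Lebesgue measure on ℝ^d × ℝ^d with sup_{k≥1} sup_{s,t ∈ ℝ^d} f_k(s,t) < ∞. Then E| (1/binom(n,2)) ∑_{1≤i<j≤n} h(X_i, X_j) − ∬ h(x,y) dF(x) dF(y) | → 0 as n → ∞. -/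
open MeasureTheory Filter Topology

/-- Mean ergodic theorem in `L¹` for square integrable observables. -/
theorem aux_mean_ergodic {α : Type*} [MeasurableSpace α] (P : Measure α) [IsProbabilityMeasure P]
    (T : α → α) (hT : Ergodic T P) (a : α → ℝ) (ha : MemLp a 2 P) :
    Tendsto (fun n : ℕ => ∫ x, |(n : ℝ)⁻¹ * (∑ i ∈ Finset.range n, a (T^[i] x)) - ∫ y, a y ∂P| ∂P)
      atTop (𝓝 0) := by
  have hTm := hT.toMeasurePreserving
  set f : Lp ℝ 2 P →L[ℝ] Lp ℝ 2 P :=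
    (Lp.compMeasurePreservingₗᵢ ℝ T hTm).toContinuousLinearMap with hf
  have hfn : ‖f‖ ≤ 1 := LinearIsometry.norm_toContinuousLinearMap_le _
  have key := ContinuousLinearMap.tendsto_birkhoffAverage_orthogonalProjection (𝕜 := ℝ) f hfn
    (ha.toLp a)
  set v := ((f.eqLocus (1 : Lp ℝ 2 P →L[ℝ] Lp ℝ 2 P)).orthogonalProjectionOnto (ha.toLp a)) with hv
  have hvfix : f (v : Lp ℝ 2 P) = v := v.2
  have hmemi : ∀ i, MemLp (fun x => a (T^[i] x)) 2 P := fun i =>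
    ha.comp_measurePreserving (hTm.iterate i)
  have hiter : ∀ i, f^[i] (ha.toLp a) = (hmemi i).toLp _ := by
    intro i
    induction i with
    | zero => rfl
    | succ i ih =>
      rw [Function.iterate_succ_apply', ih]
      rfl
  obtain ⟨c, hc⟩ : ∃ c, ((v : Lp ℝ 2 P) : α → ℝ) =ᵐ[P] Function.const α c := by
    apply hT.ae_eq_const_of_ae_eq_comp_ae (Lp.aestronglyMeasurable _)
    have h1 : (f (v : Lp ℝ 2 P) : α → ℝ) =ᵐ[P] (v : Lp ℝ 2 P) ∘ T :=
      Lp.coeFn_compMeasurePreserving _ hTm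
    rw [hvfix] at h1
    exact h1.symm
  set A : ℕ → α → ℝ := fun n x => (n : ℝ)⁻¹ * (∑ i ∈ Finset.range n, a (T^[i] x)) with hA
  have hAm : ∀ n, MemLp (A n) 2 P := fun n => by
    have := (memLp_finsetSum (Finset.range n) (fun i _ => hmemi i)).const_mul ((n : ℝ)⁻¹)
    exact this
  have hAeq : ∀ n, birkhoffAverage ℝ f _root_.id n (ha.toLp a) = (hAm n).toLp _ := by
    intro n
    have h1 : ∀ n, ∑ i ∈ Finset.range n, (hmemi i).toLp _ =
        (memLp_finsetSum (Finset.range n) (fun i _ => hmemi i)).toLp _ := by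
      intro n
      induction n with
      | zero => simp
      | succ n ih =>
        rw [Finset.sum_range_succ, ih, ← MemLp.toLp_add]
        congr 1
        ext x
        simp [Finset.sum_range_succ]
    simp only [birkhoffAverage, birkhoffSum, id, hiter]
    rw [h1, ← MemLp.toLp_const_smul]
    rfl
  have hlim : Tendsto (fun n => ∫ x, |A n x - c| ∂P) atTop (𝓝 0) := by
    have h0 : Tendsto (fun n => ‖(hAm n).toLp _ - (v : Lp ℝ 2 P)‖) atTop (𝓝 0) := by
      have := tendsto_iff_norm_sub_tendsto_zero.1 key
      simpa only [hAeq] using this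
    refine squeeze_zero (fun n => integral_nonneg fun x => abs_nonneg _) (fun n => ?_) h0
    have e1 : ((hAm n).toLp _ - (v : Lp ℝ 2 P) : Lp ℝ 2 P) =ᵐ[P] fun x => A n x - c := by
      filter_upwards [Lp.coeFn_sub ((hAm n).toLp _) (v : Lp ℝ 2 P), (hAm n).coeFn_toLp, hc]
        with x h1 h2 h3
      rw [h1, Pi.sub_apply, h2, h3]; rfl
    have hm : MemLp (fun x => A n x - c) 2 P := (hAm n).sub (memLp_const c)
    have hi : Integrable (fun x => A n x - c) P := hm.integrable (by norm_num)
    rw [Lp.norm_def, eLpNorm_congr_ae e1]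
    have h2 : ∫ x, |A n x - c| ∂P = (eLpNorm (fun x => A n x - c) 1 P).toReal := by
      rw [eLpNorm_one_eq_lintegral_enorm, ← integral_norm_eq_lintegral_enorm hi.1]
      rfl
    rw [h2]
    exact ENNReal.toReal_mono hm.2.ne
      (eLpNorm_le_eLpNorm_of_exponent_le (by norm_num) hm.1)
  have hci : ∫ y, a y ∂P = c := by
    have hb : ∀ n : ℕ, 1 ≤ n → |∫ y, a y ∂P - c| ≤ ∫ x, |A n x - c| ∂P := by
      intro n hn
      have hAi : Integrable (A n) P := (hAm n).integrable (by norm_num)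
      have h3 : ∫ x, A n x ∂P = ∫ y, a y ∂P := by
        simp only [hA]
        rw [integral_const_mul, integral_finsetSum _
          (fun i _ => (hmemi i).integrable (by norm_num))]
        have : ∀ i, ∫ x, a (T^[i] x) ∂P = ∫ y, a y ∂P := by
          intro i
          have hmp := hTm.iterate i
          conv_rhs => rw [← hmp.map_eq]
          rw [integral_map hmp.measurable.aemeasurable]
          rw [hmp.map_eq]; exact ha.1
        simp only [this]
        simp
        field_simp
      rw [← h3]
      have : ∫ x, A n x ∂P - c = ∫ x, (A n x - c) ∂P := by
        rw [integral_sub hAi (integrable_const c)]; simp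
      rw [this]
      exact abs_integral_le_integral_abs
    have : |∫ y, a y ∂P - c| ≤ 0 :=
      ge_of_tendsto hlim (eventually_atTop.2 ⟨1, hb⟩)
    have := abs_nonpos_iff.1 this
    linarith
  rw [hci]
  exact hlim

theorem aux_rect_identity (a b : ℕ → ℝ) (p q : ℝ) (n : ℕ) :
    (∑ j ∈ Finset.range n, ∑ i ∈ Finset.range j, a i * b j) - (n.choose 2 : ℝ) * (p * q)
    = (∑ j ∈ Finset.range n, b j * ∑ i ∈ Finset.range j, (a i - p))
      + p * (n * (∑ j ∈ Finset.range n, (b j - q))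
        - ∑ i ∈ Finset.range (n + 1), ∑ j ∈ Finset.range i, (b j - q)) := by
  induction n with
  | zero => simp
  | succ n ih =>
    have hc : ((n + 1).choose 2 : ℝ) = n + (n.choose 2 : ℝ) := by
      rw [Nat.choose_succ_succ' n 1]; simp
    have h1 : ∑ i ∈ Finset.range n, a i * b n = (∑ i ∈ Finset.range n, a i) * b n := by
      rw [Finset.sum_mul]
    have h2 : ∑ i ∈ Finset.range n, (a i - p) = (∑ i ∈ Finset.range n, a i) - n * p := by
      simp [Finset.sum_sub_distrib]
    rw [Finset.sum_range_succ _ (n + 1), Finset.sum_range_succ _ n,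
      Finset.sum_range_succ (fun j => b j * ∑ i ∈ Finset.range j, (a i - p)) n,
      Finset.sum_range_succ (fun j => b j - q) n, hc, h1, h2]
    push_cast
    linear_combination ih

theorem aux_rect {Ω : Type*} [MeasurableSpace Ω] (μ : Measure Ω) [IsProbabilityMeasure μ]
    (a b : ℕ → Ω → ℝ) (ham : ∀ i, Measurable (a i)) (hbm : ∀ i, Measurable (b i))
    (ha : ∀ i ω, |a i ω| ≤ 1) (hb : ∀ i ω, |b i ω| ≤ 1) (p q : ℝ) (hp : |p| ≤ 1)
    (hA : Tendsto (fun n : ℕ => ∫ ω, |(n : ℝ)⁻¹ * (∑ i ∈ Finset.range n, a i ω) - p| ∂μ)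
      atTop (𝓝 0))
    (hB : Tendsto (fun n : ℕ => ∫ ω, |(n : ℝ)⁻¹ * (∑ i ∈ Finset.range n, b i ω) - q| ∂μ)
      atTop (𝓝 0)) :
    Tendsto (fun n : ℕ => ∫ ω, |(n.choose 2 : ℝ)⁻¹ *
      (∑ j ∈ Finset.range n, ∑ i ∈ Finset.range j, a i ω * b j ω) - p * q| ∂μ) atTop (𝓝 0) := by
  have hai : ∀ i, Integrable (a i) μ := fun i =>
    Integrable.of_bound (ham i).aestronglyMeasurable 1 (ae_of_all _ (ha i))
  have hbi : ∀ i, Integrable (b i) μ := fun i =>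
    Integrable.of_bound (hbm i).aestronglyMeasurable 1 (ae_of_all _ (hb i))
  have hD : ∀ (c : ℕ → Ω → ℝ) (r : ℝ) (n : ℕ),
      ∫ ω, |∑ i ∈ Finset.range n, (c i ω - r)| ∂μ
        = n * ∫ ω, |(n : ℝ)⁻¹ * (∑ i ∈ Finset.range n, c i ω) - r| ∂μ := by
    intro c r n
    rcases Nat.eq_zero_or_pos n with rfl | hn
    · simp
    rw [← integral_const_mul]
    congr 1
    ext ω
    have hn' : (0 : ℝ) < n := by exact_mod_cast hn
    rw [← abs_of_pos hn', ← abs_mul, abs_of_pos hn']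
    congr 1
    rw [Finset.sum_sub_distrib]
    simp
    field_simp
  set eA : ℕ → ℝ := fun n => ∫ ω, |(n : ℝ)⁻¹ * (∑ i ∈ Finset.range n, a i ω) - p| ∂μ with heA
  set eB : ℕ → ℝ := fun n => ∫ ω, |(n : ℝ)⁻¹ * (∑ i ∈ Finset.range n, b i ω) - q| ∂μ with heB
  have eA0 : ∀ n, 0 ≤ eA n := fun n => integral_nonneg fun _ => abs_nonneg _
  have eB0 : ∀ n, 0 ≤ eB n := fun n => integral_nonneg fun _ => abs_nonneg _
  have hlim : Tendsto (fun n : ℕ => 4 * (((n : ℝ)⁻¹ * ∑ j ∈ Finset.range n, eA j) + 2 * eB n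
      + ((n : ℝ)⁻¹ * ∑ j ∈ Finset.range n, eB j))) atTop (𝓝 0) := by
    have := ((hA.cesaro.add (hB.const_mul 2)).add hB.cesaro).const_mul 4
    simpa using this
  refine squeeze_zero' (Eventually.of_forall fun n => integral_nonneg fun _ => abs_nonneg _)
    ?_ hlim
  filter_upwards [eventually_ge_atTop 2] with n hn
  have hn2 : (2 : ℝ) ≤ n := by exact_mod_cast hn
  have hc : (n.choose 2 : ℝ) = n * (n - 1) / 2 := Nat.cast_choose_two ℝ n
  have hcpos : (0 : ℝ) < n.choose 2 := by rw [hc]; nlinarith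
  have hSA : ∀ j, Integrable (fun ω => ∑ i ∈ Finset.range j, (a i ω - p)) μ := fun j =>
    integrable_finsetSum _ fun i _ => (hai i).sub (integrable_const p)
  have hSB : ∀ j, Integrable (fun ω => ∑ i ∈ Finset.range j, (b i ω - q)) μ := fun j =>
    integrable_finsetSum _ fun i _ => (hbi i).sub (integrable_const q)
  have hpt : ∀ ω, |(n.choose 2 : ℝ)⁻¹ *
      (∑ j ∈ Finset.range n, ∑ i ∈ Finset.range j, a i ω * b j ω) - p * q| ≤
      (n.choose 2 : ℝ)⁻¹ * ((∑ j ∈ Finset.range n, |∑ i ∈ Finset.range j, (a i ω - p)|)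
        + (n * |∑ j ∈ Finset.range n, (b j ω - q)|
          + ∑ i ∈ Finset.range (n + 1), |∑ j ∈ Finset.range i, (b j ω - q)|)) := by
    intro ω
    have h1 : (n.choose 2 : ℝ)⁻¹ *
      (∑ j ∈ Finset.range n, ∑ i ∈ Finset.range j, a i ω * b j ω) - p * q =
      (n.choose 2 : ℝ)⁻¹ *
      ((∑ j ∈ Finset.range n, ∑ i ∈ Finset.range j, a i ω * b j ω)
        - (n.choose 2 : ℝ) * (p * q)) := by field_simp
    rw [h1, aux_rect_identity (fun i => a i ω) (fun i => b i ω), abs_mul,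
      abs_of_pos (inv_pos.2 hcpos)]
    gcongr
    refine (abs_add_le _ _).trans (add_le_add ?_ ?_)
    · refine (Finset.abs_sum_le_sum_abs _ _).trans (Finset.sum_le_sum fun j _ => ?_)
      rw [abs_mul]
      exact mul_le_of_le_one_left (abs_nonneg _) (hb j ω)
    · rw [abs_mul]
      refine (mul_le_of_le_one_left (abs_nonneg _) hp).trans ?_
      refine (abs_sub _ _).trans (add_le_add ?_ ?_)
      · rw [abs_mul]; simp
      · exact Finset.abs_sum_le_sum_abs _ _
  have i1 : Integrable (fun ω => ∑ j ∈ Finset.range n, |∑ i ∈ Finset.range j, (a i ω - p)|) μ :=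
    integrable_finsetSum _ fun j _ => (hSA j).abs
  have i2 : Integrable (fun ω => n * |∑ j ∈ Finset.range n, (b j ω - q)|) μ :=
    (hSB n).abs.const_mul _
  have i3 : Integrable
      (fun ω => ∑ i ∈ Finset.range (n + 1), |∑ j ∈ Finset.range i, (b j ω - q)|) μ :=
    integrable_finsetSum _ fun j _ => (hSB j).abs
  refine (integral_mono_of_nonneg (ae_of_all _ fun _ => abs_nonneg _)
    ((i1.add (i2.add i3)).const_mul _) (ae_of_all _ hpt)).trans ?_
  have hval : ∫ ω, (n.choose 2 : ℝ)⁻¹ *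
      ((∑ j ∈ Finset.range n, |∑ i ∈ Finset.range j, (a i ω - p)|)
        + (n * |∑ j ∈ Finset.range n, (b j ω - q)|
          + ∑ i ∈ Finset.range (n + 1), |∑ j ∈ Finset.range i, (b j ω - q)|)) ∂μ
      = (n.choose 2 : ℝ)⁻¹ * ((∑ j ∈ Finset.range n, j * eA j) + (n * (n * eB n)
        + ∑ j ∈ Finset.range (n + 1), j * eB j)) := by
    have i23 : Integrable (fun ω => n * |∑ j ∈ Finset.range n, (b j ω - q)|
        + ∑ i ∈ Finset.range (n + 1), |∑ j ∈ Finset.range i, (b j ω - q)|) μ := i2.add i3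
    rw [integral_const_mul, integral_add i1 i23, integral_add i2 i3,
      integral_finsetSum _ (fun j _ => (hSA j).abs), integral_const_mul,
      integral_finsetSum _ (fun j _ => (hSB j).abs)]
    simp only [hD]
    rfl
  refine hval.le.trans ?_
  have hle : ∀ e : ℕ → ℝ, (∀ n, 0 ≤ e n) → ∑ j ∈ Finset.range n, j * e j
      ≤ n * ∑ j ∈ Finset.range n, e j := by
    intro e he
    rw [Finset.mul_sum]
    refine Finset.sum_le_sum fun j hj => ?_
    have : (j : ℝ) ≤ n := by exact_mod_cast (Finset.mem_range.1 hj).le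
    exact mul_le_mul_of_nonneg_right this (he j)
  have hA1 := hle eA eA0
  have hB1 := hle eB eB0
  rw [Finset.sum_range_succ]
  have sA0 : 0 ≤ ∑ j ∈ Finset.range n, eA j := Finset.sum_nonneg fun j _ => eA0 j
  have sB0 : 0 ≤ ∑ j ∈ Finset.range n, eB j := Finset.sum_nonneg fun j _ => eB0 j
  have hci : (n.choose 2 : ℝ)⁻¹ ≤ 4 * ((n : ℝ)⁻¹ * (n : ℝ)⁻¹) := by
    rw [hc, ← mul_inv, inv_eq_one_div, inv_eq_one_div, ← mul_div_assoc, div_le_div_iff₀]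
    · nlinarith
    · nlinarith
    · nlinarith
  have eBn := eB0 n
  calc _ ≤ (n.choose 2 : ℝ)⁻¹ * (n * (∑ j ∈ Finset.range n, eA j) + (n * (n * eB n)
        + (n * (∑ j ∈ Finset.range n, eB j) + n * (n * eB n)))) := by
        gcongr
        nlinarith
    _ ≤ (4 * ((n : ℝ)⁻¹ * (n : ℝ)⁻¹)) * (n * (∑ j ∈ Finset.range n, eA j) + (n * (n * eB n)
        + (n * (∑ j ∈ Finset.range n, eB j) + n * (n * eB n)))) := by
        gcongr
    _ = _ := by
        field_simp
        ring

/-- The U-statistic of order two for the sequence `Y 0, Y 1, …`. -/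
noncomputable def auxU {Ω E : Type*} (Y : ℕ → Ω → E) (g : E × E → ℝ) (n : ℕ) (ω : Ω) : ℝ :=
  (n.choose 2 : ℝ)⁻¹ * ∑ j ∈ Finset.range n, ∑ i ∈ Finset.range j, g (Y i ω, Y j ω)

/-- `L¹` convergence of the U-statistic with kernel `g` to `∫ g ∂G`. -/
def auxGood {Ω E : Type*} [MeasurableSpace Ω] [MeasurableSpace E] (μ : Measure Ω)
    (Y : ℕ → Ω → E) (G : Measure (E × E)) (g : E × E → ℝ) : Prop :=
  Tendsto (fun n => ∫⁻ ω, ‖auxU Y g n ω - ∫ z, g z ∂G‖ₑ ∂μ) atTop (𝓝 0)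

set_option linter.unusedSectionVars false

section
variable {Ω E : Type*} [MeasurableSpace Ω] [MeasurableSpace E] {μ : Measure Ω}
    {Y : ℕ → Ω → E} {G : Measure (E × E)}

theorem auxU_measurable (hY : ∀ i, Measurable (Y i)) {g : E × E → ℝ} (hg : Measurable g) (n : ℕ) :
    Measurable (auxU Y g n) := by
  unfold auxU
  refine Measurable.const_mul (Finset.measurable_sum _ fun j _ =>
    Finset.measurable_sum _ fun i _ => ?_) _
  exact hg.comp ((hY i).prodMk (hY j))

theorem auxU_add (g g' : E × E → ℝ) (n : ℕ) (ω : Ω) :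
    auxU Y (g + g') n ω = auxU Y g n ω + auxU Y g' n ω := by
  simp [auxU, Finset.sum_add_distrib, mul_add]

theorem auxU_smul (c : ℝ) (g : E × E → ℝ) (n : ℕ) (ω : Ω) :
    auxU Y (c • g) n ω = c * auxU Y g n ω := by
  simp only [auxU, Pi.smul_apply, smul_eq_mul, ← Finset.mul_sum]
  ring

theorem auxGood.add (hY : ∀ i, Measurable (Y i)) {g g' : E × E → ℝ} (hgm : Measurable g)
    (hgi : Integrable g G) (hgi' : Integrable g' G)
    (h : auxGood μ Y G g) (h' : auxGood μ Y G g') : auxGood μ Y G (g + g') := by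
  have := Filter.Tendsto.add h h'
  rw [add_zero] at this
  refine tendsto_of_tendsto_of_tendsto_of_le_of_le tendsto_const_nhds this
    (fun n => zero_le) (fun n => ?_)
  dsimp only
  rw [← lintegral_add_left]
  · refine lintegral_mono fun ω => ?_
    rw [auxU_add]
    have : ∫ z, (g + g') z ∂G = ∫ z, g z ∂G + ∫ z, g' z ∂G := integral_add hgi hgi'
    rw [this, add_sub_add_comm]
    exact enorm_add_le _ _
  · exact ((auxU_measurable hY hgm n).sub_const _).enorm

theorem auxGood.smul (c : ℝ) {g : E × E → ℝ} 
    (h : auxGood μ Y G g) : auxGood μ Y G (c • g) := by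
  have : Tendsto (fun n => ‖c‖ₑ * ∫⁻ ω, ‖auxU Y g n ω - ∫ z, g z ∂G‖ₑ ∂μ) atTop
      (𝓝 (‖c‖ₑ * 0)) := ENNReal.Tendsto.const_mul h (Or.inr enorm_ne_top)
  rw [mul_zero] at this
  refine this.congr fun n => ?_
  rw [← lintegral_const_mul' _ _ enorm_ne_top]
  refine lintegral_congr fun ω => ?_
  rw [auxU_smul, ← enorm_mul]
  congr 1
  simp only [Pi.smul_apply, smul_eq_mul, integral_const_mul]
  ring

theorem aux_count (n : ℕ) :
    (∑ j ∈ Finset.range n, ∑ _i ∈ Finset.range j, (1 : ENNReal)) = (n.choose 2 : ENNReal) := by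
  simp only [Finset.sum_const, Finset.card_range, nsmul_eq_mul, mul_one]
  rw [← Nat.cast_sum, Finset.sum_range_id, Nat.choose_two_right]

theorem auxU_bound (hY : ∀ i, Measurable (Y i)) {ν : ℕ → Measure (E × E)}
    (hν : ∀ i k, 1 ≤ k → Measure.map (fun ω => (Y i ω, Y (i + k) ω)) μ = ν k)
    {g : E × E → ℝ} (hg : Measurable g) {ε : ENNReal} 
    (hε : ∀ k, 1 ≤ k → ∫⁻ z, ‖g z‖ₑ ∂(ν k) ≤ ε) (n : ℕ) :
    ∫⁻ ω, ‖auxU Y g n ω‖ₑ ∂μ ≤ ε := by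
  have hgij : ∀ i j, Measurable (fun ω => ‖g (Y i ω, Y j ω)‖ₑ) := fun i j =>
    (hg.comp ((hY i).prodMk (hY j))).enorm
  have hij : ∀ i j, i < j → ∫⁻ ω, ‖g (Y i ω, Y j ω)‖ₑ ∂μ ≤ ε := by
    intro i j h
    obtain ⟨k, rfl⟩ := Nat.exists_eq_add_of_lt h
    have := hε (k + 1) (by omega)
    rw [← hν i (k + 1) (by omega), lintegral_map hg.enorm ((hY _).prodMk (hY _))] at this
    exact this
  calc ∫⁻ ω, ‖auxU Y g n ω‖ₑ ∂μ
      ≤ ∫⁻ ω, ‖(n.choose 2 : ℝ)⁻¹‖ₑ *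
          ∑ j ∈ Finset.range n, ∑ i ∈ Finset.range j, ‖g (Y i ω, Y j ω)‖ₑ ∂μ := by
        refine lintegral_mono fun ω => ?_
        rw [auxU, enorm_mul]
        gcongr
        refine (enorm_sum_le _ _).trans (Finset.sum_le_sum fun j _ => enorm_sum_le _ _)
    _ = ‖(n.choose 2 : ℝ)⁻¹‖ₑ *
          ∑ j ∈ Finset.range n, ∑ i ∈ Finset.range j, ∫⁻ ω, ‖g (Y i ω, Y j ω)‖ₑ ∂μ := by
        rw [lintegral_const_mul' _ _ enorm_ne_top,
          lintegral_finsetSum _ fun j _ => Finset.measurable_sum _ fun i _ => hgij i j]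
        congr 1
        refine Finset.sum_congr rfl fun j _ => ?_
        rw [lintegral_finsetSum _ fun i _ => hgij i j]
    _ ≤ ‖(n.choose 2 : ℝ)⁻¹‖ₑ * ∑ j ∈ Finset.range n, ∑ i ∈ Finset.range j, 1 * ε := by
        gcongr with j hj i hi
        rw [one_mul]
        exact hij i j (Finset.mem_range.1 hi)
    _ = ‖(n.choose 2 : ℝ)⁻¹‖ₑ * (n.choose 2 : ENNReal) * ε := by
        simp only [← Finset.sum_mul]
        rw [aux_count, mul_assoc]
    _ ≤ 1 * ε := by
        gcongr
        rcases Nat.eq_zero_or_pos (n.choose 2) with h0 | h0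
        · simp [h0]
        · rw [enorm_inv (by positivity)]
          have : ‖(n.choose 2 : ℝ)‖ₑ = (n.choose 2 : ENNReal) := by
            rw [Real.enorm_eq_ofReal (by positivity)]; simp
          rw [this]
          exact ENNReal.inv_mul_le_one _
    _ = ε := one_mul _

theorem auxGood.closure [IsProbabilityMeasure μ] (hY : ∀ i, Measurable (Y i))
    {ν : ℕ → Measure (E × E)}
    (hν : ∀ i k, 1 ≤ k → Measure.map (fun ω => (Y i ω, Y (i + k) ω)) μ = ν k)
    {g : E × E → ℝ} (hg : Measurable g) (hgi : Integrable g G)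
    (H : ∀ ε : ENNReal, 0 < ε → ∃ g' : E × E → ℝ, Measurable g' ∧ Integrable g' G ∧
      auxGood μ Y G g' ∧ (∀ k, 1 ≤ k → ∫⁻ z, ‖g z - g' z‖ₑ ∂(ν k) ≤ ε) ∧
      ∫⁻ z, ‖g z - g' z‖ₑ ∂G ≤ ε) : auxGood μ Y G g := by
  rw [auxGood, ENNReal.tendsto_nhds_zero]
  intro ε hε
  have hε3 : 0 < ε / 3 := ENNReal.div_pos hε.ne' (by simp)
  obtain ⟨g', hg'm, hg'i, hgood, h1, h2⟩ := H (ε / 3) hε3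
  rw [auxGood, ENNReal.tendsto_nhds_zero] at hgood
  filter_upwards [hgood _ hε3] with n hn
  have h3 : ∫⁻ ω, ‖auxU Y (g - g') n ω‖ₑ ∂μ ≤ ε / 3 :=
    auxU_bound hY hν (hg.sub hg'm) h1 n
  have h4 : ‖∫ z, g' z ∂G - ∫ z, g z ∂G‖ₑ ≤ ε / 3 := by
    rw [← integral_sub hg'i hgi]
    refine (enorm_integral_le_lintegral_enorm _).trans ?_
    refine le_trans (lintegral_mono fun z => ?_) h2
    rw [enorm_sub_rev]
  have hm1 : Measurable fun ω => ‖auxU Y (g - g') n ω‖ₑ :=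
    (auxU_measurable hY (hg.sub hg'm) n).enorm
  have hm2 : Measurable fun ω => ‖auxU Y g' n ω - ∫ z, g' z ∂G‖ₑ :=
    ((auxU_measurable hY hg'm n).sub_const _).enorm
  calc ∫⁻ ω, ‖auxU Y g n ω - ∫ z, g z ∂G‖ₑ ∂μ
      ≤ ∫⁻ ω, (‖auxU Y (g - g') n ω‖ₑ + ‖auxU Y g' n ω - ∫ z, g' z ∂G‖ₑ
        + ‖∫ z, g' z ∂G - ∫ z, g z ∂G‖ₑ) ∂μ := by
        refine lintegral_mono fun ω => ?_
        have : auxU Y g n ω = auxU Y (g - g') n ω + auxU Y g' n ω := by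
          rw [← auxU_add, sub_add_cancel]
        have e : auxU Y g n ω - ∫ z, g z ∂G = auxU Y (g - g') n ω
          + (auxU Y g' n ω - ∫ z, g' z ∂G) + (∫ z, g' z ∂G - ∫ z, g z ∂G) := by
          rw [this]; ring
        rw [e]
        exact (enorm_add_le _ _).trans (add_le_add_left (enorm_add_le _ _) _)
    _ ≤ ε / 3 + ε / 3 + ε / 3 := by
        rw [lintegral_add_right _ measurable_const, lintegral_add_left hm1]
        gcongr
        simpa using h4
    _ = ε := ENNReal.add_thirds ε

theorem auxGood.of_sets [IsProbabilityMeasure μ] (hY : ∀ i, Measurable (Y i))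
    [IsProbabilityMeasure G] {ν : ℕ → Measure (E × E)}
    (hν : ∀ i k, 1 ≤ k → Measure.map (fun ω => (Y i ω, Y (i + k) ω)) μ = ν k)
    (hUC : ∀ T : ℕ → Set (E × E), (∀ m, MeasurableSet (T m)) → Antitone T → ⋂ m, T m = ∅ →
      ∀ ε : ENNReal, 0 < ε → ∃ m, ∀ m', m ≤ m' → ∀ k, 1 ≤ k → ν k (T m') ≤ ε)
    (hrect : ∀ A B : Set E, MeasurableSet A → MeasurableSet B →
      auxGood μ Y G ((A ×ˢ B).indicator 1)) :
    ∀ S : Set (E × E), MeasurableSet S → auxGood μ Y G (S.indicator 1) := by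
  have hind : ∀ S : Set (E × E), MeasurableSet S →
      Measurable (S.indicator (1 : E × E → ℝ)) ∧ Integrable (S.indicator (1 : E × E → ℝ)) G := by
    intro S hS
    exact ⟨measurable_one.indicator hS, (integrable_const (1 : ℝ)).indicator hS⟩
  have huniv : auxGood μ Y G ((Set.univ : Set (E × E)).indicator 1) := by
    rw [← Set.univ_prod_univ]; exact hrect _ _ .univ .univ
  have hempty : auxGood μ Y G ((∅ : Set (E × E)).indicator 1) := by
    have := hrect ∅ ∅ .empty .empty
    simpa using this
  refine MeasurableSpace.induction_on_inter generateFrom_prod.symm isPiSystem_prod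
    hempty ?_ ?_ ?_
  · rintro _ ⟨A, hA, B, hB, rfl⟩
    exact hrect A B hA hB
  · intro S hS h
    have e : (Sᶜ.indicator (1 : E × E → ℝ))
        = Set.univ.indicator 1 + (-1 : ℝ) • S.indicator 1 := by
      ext z
      by_cases hz : z ∈ S <;> simp [hz]
    rw [e]
    exact auxGood.add hY (hind _ .univ).1 (hind _ .univ).2 ((hind S hS).2.smul (-1 : ℝ)) huniv
      (h.smul _)
  · intro f hdisj hfm hf
    have hpart : ∀ m : ℕ, auxGood μ Y G ((⋃ i ∈ Finset.range m, f i).indicator 1) := by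
      intro m
      induction m with
      | zero => simpa using hempty
      | succ m ih =>
        have e : ((⋃ i ∈ Finset.range (m + 1), f i).indicator (1 : E × E → ℝ))
            = (⋃ i ∈ Finset.range m, f i).indicator 1 + (f m).indicator 1 := by
          refine Eq.trans ?_ (Set.indicator_union_of_disjoint ?_ (1 : E × E → ℝ))
          · congr 1
            ext z
            simp only [Finset.mem_range, Set.mem_iUnion, Set.mem_union, Nat.lt_succ_iff_lt_or_eq]
            constructor
            · rintro ⟨i, hi | rfl, hz⟩
              · exact Or.inl ⟨i, hi, hz⟩
              · exact Or.inr hz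
            · rintro (⟨i, hi, hz⟩ | hz)
              · exact ⟨i, Or.inl hi, hz⟩
              · exact ⟨m, Or.inr rfl, hz⟩
          · simp only [Set.disjoint_iUnion_left]
            intro i hi
            exact hdisj (Finset.mem_range.1 hi).ne
        have hm : MeasurableSet (⋃ i ∈ Finset.range m, f i) :=
          Finset.measurableSet_biUnion _ fun i _ => hfm i
        rw [e]
        exact auxGood.add hY (hind _ hm).1 (hind _ hm).2 (hind _ (hfm m)).2 ih (hf m)
    have hSm : MeasurableSet (⋃ i, f i) := .iUnion hfm
    refine auxGood.closure hY hν (hind _ hSm).1 (hind _ hSm).2 fun ε hε => ?_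
    set T : ℕ → Set (E × E) := fun m => ⋃ i ≥ m, f i with hT
    have hTm : ∀ m, MeasurableSet (T m) := fun m =>
      .iUnion fun i => .iUnion fun _ => hfm i
    have hTa : Antitone T := by
      intro m m' hmm
      exact Set.iUnion_mono fun i => Set.iUnion_mono' fun h => ⟨le_trans hmm h, le_rfl⟩
    have hTe : ⋂ m, T m = ∅ := by
      ext z
      simp only [hT, Set.mem_iInter, Set.mem_iUnion, Set.mem_empty_iff_false, iff_false]
      intro hz
      obtain ⟨i, _, hi⟩ := hz 0
      obtain ⟨j, hj, hj'⟩ := hz (i + 1)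
      have hne : i ≠ j := by omega
      exact Set.disjoint_left.1 (hdisj hne) hi hj'
    obtain ⟨m1, hm1⟩ := hUC T hTm hTa hTe ε hε
    have hG : Tendsto (fun m => G (T m)) atTop (𝓝 0) := by
      have := tendsto_measure_iInter_atTop (μ := G) (fun m => (hTm m).nullMeasurableSet) hTa
        ⟨0, measure_ne_top _ _⟩
      rwa [hTe, measure_empty] at this
    rw [ENNReal.tendsto_nhds_zero] at hG
    obtain ⟨m2, hm2⟩ := eventually_atTop.1 (hG ε hε)
    set m := max m1 m2
    have hm : MeasurableSet (⋃ i ∈ Finset.range m, f i) :=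
      Finset.measurableSet_biUnion _ fun i _ => hfm i
    have hdiff : ∀ z, ‖(⋃ i, f i).indicator (1 : E × E → ℝ) z
        - (⋃ i ∈ Finset.range m, f i).indicator 1 z‖ₑ ≤ (T m).indicator 1 z := by
      intro z
      by_cases hz : z ∈ T m
      · rw [Set.indicator_of_mem hz]
        by_cases h1 : z ∈ ⋃ i, f i <;> by_cases h2 : z ∈ ⋃ i ∈ Finset.range m, f i
        all_goals simp only [Set.indicator, h1, h2, if_true, if_false]; simp
      · have : z ∈ (⋃ i, f i) ↔ z ∈ ⋃ i ∈ Finset.range m, f i := by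
          simp only [Set.mem_iUnion, Finset.mem_range]
          constructor
          · rintro ⟨i, hi⟩
            refine ⟨i, ?_, hi⟩
            by_contra hc
            exact hz (Set.mem_iUnion₂.2 ⟨i, not_lt.1 hc, hi⟩)
          · rintro ⟨i, _, hi⟩
            exact ⟨i, hi⟩
        by_cases h2 : z ∈ ⋃ i ∈ Finset.range m, f i
        · rw [Set.indicator_of_mem h2, Set.indicator_of_mem (this.2 h2)]; simp
        · rw [Set.indicator_of_notMem h2, Set.indicator_of_notMem (fun h => h2 (this.1 h))]; simp
    refine ⟨_, (hind _ hm).1, (hind _ hm).2, hpart m, fun k hk => ?_, ?_⟩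
    · refine (lintegral_mono hdiff).trans ?_
      rw [lintegral_indicator_one (hTm m)]
      exact hm1 m (le_max_left _ _) k hk
    · refine (lintegral_mono hdiff).trans ?_
      rw [lintegral_indicator_one (hTm m)]
      exact hm2 m (le_max_right _ _)

theorem auxGood.of_bounded [IsProbabilityMeasure μ] (hY : ∀ i, Measurable (Y i))
    [IsProbabilityMeasure G] {ν : ℕ → Measure (E × E)}
    (hν : ∀ i k, 1 ≤ k → Measure.map (fun ω => (Y i ω, Y (i + k) ω)) μ = ν k)
    (hsets : ∀ S : Set (E × E), MeasurableSet S → auxGood μ Y G (S.indicator 1))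
    (g : E × E → ℝ) (hg : Measurable g) (M : ℝ) (hM : ∀ z, |g z| ≤ M) : auxGood μ Y G g := by
  have hνp : ∀ k, 1 ≤ k → IsProbabilityMeasure (ν k) := fun k hk => by
    rw [← hν 0 k hk]
    exact Measure.isProbabilityMeasure_map ((hY _).prodMk (hY _)).aemeasurable
  have hsimple : ∀ s : SimpleFunc (E × E) ℝ, auxGood μ Y G s := by
    intro s
    induction s using SimpleFunc.induction with
    | const c hS =>
      rename_i S
      have : (⇑(SimpleFunc.piecewise S hS (SimpleFunc.const (E × E) c) (SimpleFunc.const (E × E) 0)))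
          = c • S.indicator (1 : E × E → ℝ) := by
        ext z
        by_cases hz : z ∈ S <;> simp [hz]
      rw [this]
      exact (hsets S hS).smul c
    | add _ h1 h2 =>
      rename_i s1 s2 _
      rw [SimpleFunc.coe_add]
      exact auxGood.add hY s1.measurable (s1.integrable_of_isFiniteMeasure)
        (s2.integrable_of_isFiniteMeasure) h1 h2
  refine auxGood.closure hY hν hg
    (Integrable.of_bound hg.aestronglyMeasurable M (ae_of_all _ hM)) fun ε hε => ?_
  obtain ⟨δ, hδ, hδε⟩ : ∃ δ : ℝ, 0 < δ ∧ ENNReal.ofReal δ ≤ ε := by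
    obtain ⟨r, hr0, hr⟩ := ENNReal.lt_iff_exists_nnreal_btwn.1 hε
    refine ⟨r, by exact_mod_cast hr0, ?_⟩
    simpa using hr.le
  have hfl : Measurable fun z => ⌊g z / δ⌋ := (hg.div_const δ).floor
  let s : SimpleFunc (E × E) ℝ :=
    { toFun := fun z => δ * (⌊g z / δ⌋ : ℝ)
      measurableSet_fiber' := fun x => by
        have : Measurable fun z => δ * (⌊g z / δ⌋ : ℝ) :=
          ((measurable_from_top (f := fun i : ℤ => (i : ℝ))).comp hfl).const_mul δ
        exact this (measurableSet_singleton x)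
      finite_range' := by
        refine Set.Finite.subset ((Set.finite_Icc ⌊-M / δ⌋ ⌊M / δ⌋).image
          (fun i : ℤ => δ * (i : ℝ))) ?_
        rintro _ ⟨z, rfl⟩
        refine ⟨⌊g z / δ⌋, ⟨Int.floor_mono ?_, Int.floor_mono ?_⟩, rfl⟩
        · have := (abs_le.1 (hM z)).1
          gcongr
        · have := (abs_le.1 (hM z)).2
          gcongr }
  have hs : ∀ z, ‖g z - s z‖ₑ ≤ ε := by
    intro z
    refine le_trans ?_ hδε
    rw [Real.enorm_eq_ofReal_abs]
    apply ENNReal.ofReal_le_ofReal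
    change |g z - δ * (⌊g z / δ⌋ : ℝ)| ≤ δ
    have h1 := Int.floor_le (g z / δ)
    have h2 := (Int.lt_floor_add_one (g z / δ)).le
    have e : g z = δ * (g z / δ) := by field_simp
    have h1' := mul_le_mul_of_nonneg_left h1 hδ.le
    have h2' := mul_le_mul_of_nonneg_left h2 hδ.le
    rw [← e] at h1' h2'
    rw [abs_le]
    constructor <;> linarith
  refine ⟨s, s.measurable, s.integrable_of_isFiniteMeasure, hsimple s, fun k hk => ?_, ?_⟩
  · have := hνp k hk
    refine (lintegral_mono hs).trans ?_
    simp
  · refine (lintegral_mono hs).trans ?_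
    simp

end

/-- `L¹` convergence of the U-statistic for a stationary ergodic `ℝ^d`-valued sequence
`(X_i)_{i ≥ 0}` with a measurable kernel such that `{h(X_1, X_j) : j ≥ 1}` is uniformly
integrable and `∬ |h| dF dF < ∞`, assuming `X_0` has a bounded density and the vectors
`(X_0, X_k)` have densities uniformly bounded in `k`. Stationarity and ergodicity are
encoded by requiring that the law of the path `(X_0, X_1, …)` is invariant and ergodic
under the one-sided shift. -/
theorem stmt2 {Ω : Type*} [MeasurableSpace Ω] (μ : Measure Ω) [IsProbabilityMeasure μ]
    (d : ℕ) (X : ℕ → Ω → (Fin d → ℝ)) (hXmeas : ∀ k, Measurable (X k))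
    (hX : Ergodic (fun u : ℕ → (Fin d → ℝ) => fun n => u (n + 1))
      (Measure.map (fun ω => fun n => X n ω) μ))
    (F : Measure (Fin d → ℝ)) (hF : F = Measure.map (X 0) μ)
    (h : (Fin d → ℝ) → (Fin d → ℝ) → ℝ)
    (hmeas : Measurable (Function.uncurry h))
    (hint : ∀ j, 1 ≤ j → Integrable (fun ω => h (X 1 ω) (X j ω)) μ)
    (hUI : ∀ ε : ℝ, 0 < ε → ∃ M : ℝ, ∀ j, 1 ≤ j →
      ∫ ω in {ω | M < |h (X 1 ω) (X j ω)|}, |h (X 1 ω) (X j ω)| ∂μ ≤ ε)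
    (hintF : Integrable (fun p => h p.1 p.2) (F.prod F))
    (f0 : (Fin d → ℝ) → ENNReal) (hf0meas : Measurable f0)
    (hf0 : Measure.map (X 0) μ = volume.withDensity f0)
    (hf0bdd : ∃ C : ENNReal, C ≠ ⊤ ∧ ∀ x, f0 x ≤ C)
    (fk : ℕ → ((Fin d → ℝ) × (Fin d → ℝ)) → ENNReal)
    (hfkmeas : ∀ k, 1 ≤ k → Measurable (fk k))
    (hfk : ∀ k, 1 ≤ k →
      Measure.map (fun ω => (X 0 ω, X k ω)) μ = volume.withDensity (fk k))
    (hfkbdd : ∃ C : ENNReal, C ≠ ⊤ ∧ ∀ k, 1 ≤ k → ∀ p, fk k p ≤ C) :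
    Tendsto (fun n : ℕ => ∫ ω,
        |(n.choose 2 : ℝ)⁻¹ *
            (∑ j ∈ Finset.Icc 1 n, ∑ i ∈ Finset.Ico 1 j, h (X i ω) (X j ω))
          - ∫ p, h p.1 p.2 ∂(F.prod F)| ∂μ)
      atTop (𝓝 0) := by
  set P := Measure.map (fun ω => fun n => X n ω) μ with hP
  have hpath : Measurable (fun ω => fun n => X n ω) := measurable_pi_iff.2 hXmeas
  have hPp : IsProbabilityMeasure P := Measure.isProbabilityMeasure_map hpath.aemeasurable
  have hit : ∀ (i : ℕ), (fun u : ℕ → (Fin d → ℝ) => fun n => u (n + 1))^[i]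
      = fun u => fun n => u (n + i) := by
    intro i
    induction i with
    | zero => rfl
    | succ i ih =>
      rw [Function.iterate_succ', ih]
      funext u n
      simp only [Function.comp]
      congr 1
      omega
  -- stationarity
  have hstat : ∀ i, Measure.map (fun ω => fun n => X (n + i) ω) μ = P := by
    intro i
    have h1 := (hX.toMeasurePreserving.iterate i)
    rw [hit] at h1
    have h2 := h1.map_eq
    rw [hP, Measure.map_map h1.measurable hpath] at h2
    exact h2
  have hpathi : ∀ i, Measurable (fun ω => fun n => X (n + i) ω) := fun i =>
    measurable_pi_iff.2 fun n => hXmeas _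
  have hpair : ∀ i k, Measure.map (fun ω => (X i ω, X (i + k) ω)) μ
      = Measure.map (fun ω => (X 0 ω, X k ω)) μ := by
    intro i k
    have hm : Measurable (fun u : ℕ → (Fin d → ℝ) => (u 0, u k)) :=
      (measurable_pi_apply 0).prodMk (measurable_pi_apply k)
    have h1 : Measure.map (fun ω => (X i ω, X (i + k) ω)) μ
        = Measure.map (fun u : ℕ → (Fin d → ℝ) => (u 0, u k)) P := by
      rw [← hstat i, Measure.map_map hm (hpathi i)]
      congr 1
      funext ω
      simp [add_comm]
    have h2 : Measure.map (fun ω => (X 0 ω, X k ω)) μ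
        = Measure.map (fun u : ℕ → (Fin d → ℝ) => (u 0, u k)) P := by
      rw [hP, Measure.map_map hm hpath]
      rfl
    rw [h1, h2]
  have hmarg : ∀ i, Measure.map (X i) μ = F := by
    intro i
    have h1 := congrArg (Measure.map Prod.fst) (hpair i 0)
    rw [Measure.map_map measurable_fst ((hXmeas _).prodMk (hXmeas _)),
      Measure.map_map measurable_fst ((hXmeas _).prodMk (hXmeas _))] at h1
    rw [hF]
    exact h1
  have hFp : IsProbabilityMeasure F := by
    rw [hF]; exact Measure.isProbabilityMeasure_map (hXmeas 0).aemeasurable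
  set Y : ℕ → Ω → (Fin d → ℝ) := fun i => X (i + 1) with hYdef
  have hY : ∀ i, Measurable (Y i) := fun i => hXmeas _
  set ν : ℕ → Measure ((Fin d → ℝ) × (Fin d → ℝ)) :=
    fun k => Measure.map (fun ω => (X 0 ω, X k ω)) μ with hνdef
  have hν : ∀ i k, 1 ≤ k → Measure.map (fun ω => (Y i ω, Y (i + k) ω)) μ = ν k := by
    intro i k _
    rw [hνdef]
    simp only
    rw [← hpair (i + 1) k]
    have : i + 1 + k = i + k + 1 := by omega
    rw [this]
  -- uniform continuity of the laws at the empty set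
  have hUC : ∀ T : ℕ → Set ((Fin d → ℝ) × (Fin d → ℝ)), (∀ m, MeasurableSet (T m)) → Antitone T →
      ⋂ m, T m = ∅ →
      ∀ ε : ENNReal, 0 < ε → ∃ m, ∀ m', m ≤ m' → ∀ k, 1 ≤ k → ν k (T m') ≤ ε := by
    intro T hTm hTa hTe ε hε
    obtain ⟨C, hC, hCb⟩ := hfkbdd
    have hε3 : 0 < ε / 3 := ENNReal.div_pos hε.ne' (by simp)
    -- a large ball
    obtain ⟨R, hR⟩ : ∃ R : ℕ, F (Metric.closedBall 0 R)ᶜ ≤ ε / 3 := by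
      have h1 : Tendsto (fun R : ℕ => F (Metric.closedBall (0 : Fin d → ℝ) R)ᶜ) atTop (𝓝 0) := by
        have := tendsto_measure_iInter_atTop (μ := F)
          (s := fun R : ℕ => (Metric.closedBall (0 : Fin d → ℝ) R)ᶜ)
          (fun m => Metric.isClosed_closedBall.measurableSet.compl.nullMeasurableSet)
          (fun m m' hmm => Set.compl_subset_compl.2
            (Metric.closedBall_subset_closedBall (by exact_mod_cast hmm)))
          ⟨0, measure_ne_top _ _⟩
        rwa [← Set.compl_iUnion, Metric.iUnion_closedBall_nat, Set.compl_univ,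
          measure_empty] at this
      rw [ENNReal.tendsto_nhds_zero] at h1
      exact (h1 _ hε3).exists
    set K := Metric.closedBall (0 : Fin d → ℝ) R with hK
    have hKm : MeasurableSet K := Metric.isClosed_closedBall.measurableSet
    have hKvol : (volume : Measure (Fin d → ℝ)) K ≠ ⊤ := measure_closedBall_lt_top.ne
    have hlim : Tendsto (fun m => C * (volume : Measure ((Fin d → ℝ) × (Fin d → ℝ)))
        (T m ∩ K ×ˢ K)) atTop (𝓝 0) := by
      have h1 := tendsto_measure_iInter_atTop
        (μ := (volume : Measure ((Fin d → ℝ) × (Fin d → ℝ))))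
        (s := fun m => T m ∩ K ×ˢ K)
        (fun m => ((hTm m).inter (hKm.prod hKm)).nullMeasurableSet)
        (fun m m' hmm => Set.inter_subset_inter_left _ (hTa hmm))
        ⟨0, ne_top_of_le_ne_top (b := (volume : Measure ((Fin d → ℝ) × (Fin d → ℝ))) (K ×ˢ K)) (by
          rw [Measure.volume_eq_prod, Measure.prod_prod]
          exact ENNReal.mul_ne_top hKvol hKvol) (measure_mono Set.inter_subset_right)⟩
      rw [← Set.iInter_inter, hTe, Set.empty_inter, measure_empty] at h1
      have h2 := ENNReal.Tendsto.const_mul (a := C) h1 (Or.inr hC)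
      rwa [mul_zero] at h2
    rw [ENNReal.tendsto_nhds_zero] at hlim
    obtain ⟨m, hm⟩ := eventually_atTop.1 (hlim _ hε3)
    refine ⟨m, fun m' hmm k hk => ?_⟩
    have hsub : T m' ⊆ (T m' ∩ K ×ˢ K) ∪ (Prod.fst ⁻¹' Kᶜ) ∪ (Prod.snd ⁻¹' Kᶜ) := by
      rintro ⟨x, y⟩ hz
      by_cases hx : x ∈ K
      · by_cases hy : y ∈ K
        · exact Or.inl (Or.inl ⟨hz, hx, hy⟩)
        · exact Or.inr hy
      · exact Or.inl (Or.inr hx)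
    have b1 : ν k (T m' ∩ K ×ˢ K) ≤ ε / 3 := by
      refine le_trans ?_ (hm m' hmm)
      simp only [hνdef]
      rw [hfk k hk, withDensity_apply _ ((hTm m').inter (hKm.prod hKm))]
      refine (lintegral_mono (fun z => hCb k hk z)).trans ?_
      simp
    have b2 : ν k (Prod.fst ⁻¹' Kᶜ) ≤ ε / 3 := by
      refine le_trans (le_of_eq ?_) hR
      simp only [hνdef]
      rw [Measure.map_apply ((hXmeas _).prodMk (hXmeas _)) (measurable_fst hKm.compl),
        ← hmarg 0, Measure.map_apply (hXmeas 0) hKm.compl]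
      rfl
    have b3 : ν k (Prod.snd ⁻¹' Kᶜ) ≤ ε / 3 := by
      refine le_trans (le_of_eq ?_) hR
      simp only [hνdef]
      rw [Measure.map_apply ((hXmeas _).prodMk (hXmeas _)) (measurable_snd hKm.compl),
        ← hmarg k, Measure.map_apply (hXmeas k) hKm.compl]
      rfl
    calc ν k (T m') ≤ ν k (T m' ∩ K ×ˢ K) + ν k (Prod.fst ⁻¹' Kᶜ) + ν k (Prod.snd ⁻¹' Kᶜ) :=
          (measure_mono hsub).trans ((measure_union_le _ _).trans
            (add_le_add_left (measure_union_le _ _) _))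
      _ ≤ ε / 3 + ε / 3 + ε / 3 := by gcongr
      _ = ε := ENNReal.add_thirds ε
  -- mean ergodic theorem for indicators
  have herg : ∀ A : Set (Fin d → ℝ), MeasurableSet A →
      Tendsto (fun n : ℕ => ∫ ω, |(n : ℝ)⁻¹ * (∑ i ∈ Finset.range n,
        A.indicator (1 : (Fin d → ℝ) → ℝ) (Y i ω)) - F.real A| ∂μ) atTop (𝓝 0) := by
    intro A hA
    have hAm : Measurable (A.indicator (1 : (Fin d → ℝ) → ℝ)) := measurable_one.indicator hA
    have ham : Measurable (fun u : ℕ → (Fin d → ℝ) => A.indicator (1 : (Fin d → ℝ) → ℝ) (u 1)) :=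
      hAm.comp (measurable_pi_apply 1)
    have hmem : MemLp (fun u : ℕ → (Fin d → ℝ) => A.indicator (1 : (Fin d → ℝ) → ℝ) (u 1)) 2 P := by
      refine MemLp.of_bound ham.aestronglyMeasurable 1 (ae_of_all _ fun u => ?_)
      by_cases hu : u 1 ∈ A <;> simp [hu]
    have h1 := aux_mean_ergodic P _ hX _ hmem
    have hval : ∫ u, A.indicator (1 : (Fin d → ℝ) → ℝ) (u 1) ∂P = F.real A := by
      rw [hP, integral_map hpath.aemeasurable ham.aestronglyMeasurable, ← integral_indicator_one hA,
        ← hmarg 1, integral_map (hXmeas 1).aemeasurable hAm.aestronglyMeasurable]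
    rw [hval] at h1
    refine h1.congr fun n => ?_
    rw [hP, integral_map hpath.aemeasurable]
    · simp only [hit]
      congr 1
      funext ω
      simp only [hYdef, add_comm]
    · refine Measurable.aestronglyMeasurable ?_
      refine Measurable.abs (Measurable.sub_const (Measurable.const_mul
        (Finset.measurable_sum _ fun i _ => ?_) _) _)
      rw [hit]
      exact hAm.comp (measurable_pi_apply (1 + i))
  have hrect : ∀ A B : Set (Fin d → ℝ), MeasurableSet A → MeasurableSet B →
      auxGood μ Y (F.prod F) ((A ×ˢ B).indicator 1) := by
    intro A B hA hB
    have hb1 : ∀ (A : Set (Fin d → ℝ)) x, |A.indicator (1 : (Fin d → ℝ) → ℝ) x| ≤ 1 := by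
      intro A x
      by_cases hx : x ∈ A <;> simp [hx]
    have h1 := aux_rect μ (fun i ω => A.indicator (1 : (Fin d → ℝ) → ℝ) (Y i ω))
      (fun i ω => B.indicator (1 : (Fin d → ℝ) → ℝ) (Y i ω))
      (fun i => (measurable_one.indicator hA).comp (hY i))
      (fun i => (measurable_one.indicator hB).comp (hY i))
      (fun i ω => hb1 _ _) (fun i ω => hb1 _ _) (F.real A) (F.real B)
      (by rw [abs_of_nonneg measureReal_nonneg]; exact measureReal_le_one) (herg A hA) (herg B hB)
    have hgm : Measurable ((A ×ˢ B).indicator (1 : (Fin d → ℝ) × (Fin d → ℝ) → ℝ)) :=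
      measurable_one.indicator (hA.prod hB)
    have hv : ∫ z, (A ×ˢ B).indicator (1 : (Fin d → ℝ) × (Fin d → ℝ) → ℝ) z ∂(F.prod F)
        = F.real A * F.real B := by
      rw [integral_indicator_one (hA.prod hB), measureReal_prod_prod]
    have h2 := (ENNReal.tendsto_ofReal h1)
    rw [ENNReal.ofReal_zero] at h2
    refine h2.congr fun n => ?_
    have hpt : ∀ ω, (n.choose 2 : ℝ)⁻¹ * (∑ j ∈ Finset.range n, ∑ i ∈ Finset.range j,
        A.indicator (1 : (Fin d → ℝ) → ℝ) (Y i ω) * B.indicator (1 : (Fin d → ℝ) → ℝ) (Y j ω))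
        = auxU Y ((A ×ˢ B).indicator 1) n ω := by
      intro ω
      simp only [auxU]
      congr 1
      refine Finset.sum_congr rfl fun j _ => Finset.sum_congr rfl fun i _ => ?_
      by_cases h1 : Y i ω ∈ A <;> by_cases h2 : Y j ω ∈ B <;> simp [h1, h2]
    simp only [hpt]
    rw [hv]
    have hbound : ∀ ω, |auxU Y ((A ×ˢ B).indicator 1) n ω - F.real A * F.real B|
        = ‖auxU Y ((A ×ˢ B).indicator 1) n ω - F.real A * F.real B‖ := fun ω => rfl
    simp only [hbound]
    rw [ofReal_integral_norm_eq_lintegral_enorm]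
    have hUi : Integrable (auxU Y ((A ×ˢ B).indicator 1) n) μ := by
      unfold auxU
      refine Integrable.const_mul (integrable_finsetSum _ fun j _ =>
        integrable_finsetSum _ fun i _ => ?_) _
      refine Integrable.of_bound
        (hgm.comp ((hY i).prodMk (hY j))).aestronglyMeasurable 1 (ae_of_all _ fun ω => ?_)
      by_cases hz : (Y i ω, Y j ω) ∈ A ×ˢ B
      · rw [Set.indicator_of_mem hz]; simp
      · rw [Set.indicator_of_notMem hz]; simp
    exact hUi.sub (integrable_const _)
  have hsets := auxGood.of_sets hY hν hUC hrect
  have hbdd := auxGood.of_bounded hY hν hsets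
  set g : (Fin d → ℝ) × (Fin d → ℝ) → ℝ := Function.uncurry h with hg
  have hgi : Integrable g (F.prod F) := hintF
  have hgood : auxGood μ Y (F.prod F) g := by
    refine auxGood.closure hY hν hmeas hgi fun ε hε => ?_
    obtain ⟨δ, hδ, hδε⟩ : ∃ δ : ℝ, 0 < δ ∧ ENNReal.ofReal δ ≤ ε := by
      obtain ⟨r, hr0, hr⟩ := ENNReal.lt_iff_exists_nnreal_btwn.1 hε
      refine ⟨r, by exact_mod_cast hr0, ?_⟩
      simpa using hr.le
    obtain ⟨M1, hM1⟩ := hUI δ hδ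
    -- truncation level for the product law
    have hSm : ∀ M : ℝ, MeasurableSet {z | M < |g z|} := fun M =>
      measurableSet_lt measurable_const hmeas.abs
    have hFlim : Tendsto (fun m : ℕ => ∫⁻ z in {z | (m : ℝ) < |g z|}, ‖g z‖ₑ ∂(F.prod F))
        atTop (𝓝 0) := by
      have hd := tendsto_lintegral_of_dominated_convergence (μ := F.prod F)
        (F := fun (m : ℕ) z => {z | (m : ℝ) < |g z|}.indicator (fun z => ‖g z‖ₑ) z)
        (f := fun _ => 0) (fun z => ‖g z‖ₑ)
        (fun m => (hmeas.enorm).indicator (hSm m))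
        (fun m => ae_of_all _ fun z => Set.indicator_le_self _ _ _)
        (by exact hgi.2.ne)
        (ae_of_all _ fun z => by
          obtain ⟨N, hN⟩ := exists_nat_ge |g z|
          refine tendsto_const_nhds.congr' ?_
          filter_upwards [eventually_ge_atTop N] with m hm
          rw [Set.indicator_of_notMem]
          simp only [Set.mem_ofPred_eq, not_lt]
          exact hN.trans (by exact_mod_cast hm))
      simp only [lintegral_zero] at hd
      refine hd.congr fun m => ?_
      rw [lintegral_indicator (hSm m)]
    rw [ENNReal.tendsto_nhds_zero] at hFlim
    obtain ⟨N, hN⟩ := eventually_atTop.1 (hFlim ε hε)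
    obtain ⟨m, hm⟩ := exists_nat_ge (max M1 N)
    have hmM : M1 ≤ m := (le_max_left _ _).trans hm
    have hmN : N ≤ m := by exact_mod_cast (le_max_right M1 (N : ℝ)).trans hm
    set g' : (Fin d → ℝ) × (Fin d → ℝ) → ℝ := {z | (m : ℝ) < |g z|}ᶜ.indicator g with hg'
    have hg'm : Measurable g' := Measurable.indicator hmeas (hSm m).compl
    have hg'b : ∀ z, |g' z| ≤ m := by
      intro z
      by_cases hz : z ∈ {z | (m : ℝ) < |g z|}
      · rw [hg', Set.indicator_of_notMem (by simpa using hz)]; simp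
      · rw [hg', Set.indicator_of_mem hz]; simpa using hz
    have hdiff : ∀ z, ‖g z - g' z‖ₑ = {z | (m : ℝ) < |g z|}.indicator (fun z => ‖g z‖ₑ) z := by
      intro z
      by_cases hz : z ∈ {z | (m : ℝ) < |g z|}
      · rw [hg', Set.indicator_of_notMem (by simpa using hz), Set.indicator_of_mem hz, sub_zero]
      · rw [hg', Set.indicator_of_mem (by exact hz), Set.indicator_of_notMem hz]; simp
    refine ⟨g', hg'm, hgi.indicator (hSm m).compl, hbdd g' hg'm m hg'b, fun k hk => ?_, ?_⟩
    · simp only [hdiff]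
      refine le_trans ?_ hδε
      have hpm : Measurable fun ω => (X 1 ω, X (1 + k) ω) := (hXmeas _).prodMk (hXmeas _)
      rw [lintegral_indicator (hSm m)]
      simp only [hνdef]
      rw [← hpair 1 k, setLIntegral_map (hSm m) hmeas.enorm hpm]
      have hik : Integrable (fun ω => h (X 1 ω) (X (1 + k) ω)) μ := hint (1 + k) (by omega)
      have hss : (fun ω => (X 1 ω, X (1 + k) ω)) ⁻¹' {z | (m : ℝ) < |g z|}
          ⊆ {ω | M1 < |h (X 1 ω) (X (1 + k) ω)|} := by
        intro ω hω
        exact lt_of_le_of_lt hmM hω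
      refine (lintegral_mono_set hss).trans ?_
      refine le_trans (le_of_eq ?_) (ENNReal.ofReal_le_ofReal (hM1 (1 + k) (by omega)))
      exact (ofReal_integral_norm_eq_lintegral_enorm hik.integrableOn).symm
    · simp only [hdiff]
      rw [lintegral_indicator (hSm m)]
      exact hN m hmN
  have hfin := (ENNReal.tendsto_toReal ENNReal.zero_ne_top).comp hgood
  refine hfin.congr fun n => ?_
  simp only [Function.comp]
  rw [← integral_norm_eq_lintegral_enorm
    ((auxU_measurable hY hmeas n).sub_const _).aestronglyMeasurable]
  congr 1
  funext ω
  have hsum : ∑ j ∈ Finset.Icc 1 n, ∑ i ∈ Finset.Ico 1 j, h (X i ω) (X j ω)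
      = ∑ j ∈ Finset.range n, ∑ i ∈ Finset.range j, g (Y i ω, Y j ω) := by
    have e1 : Finset.Icc 1 n = Finset.Ico (0 + 1) (n + 1) := by
      ext x; simp only [Finset.mem_Icc, Finset.mem_Ico]; omega
    rw [e1, ← Finset.sum_Ico_add', Finset.range_eq_Ico]
    refine Finset.sum_congr rfl fun j _ => ?_
    rw [show Finset.Ico 1 (j + 1) = Finset.Ico (0 + 1) (j + 1) from rfl, ← Finset.sum_Ico_add',
      Finset.range_eq_Ico]
    rfl
  rw [hsum, Real.norm_eq_abs]
  rfl
end

section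
/- There exists a strictly stationary ergodic sequence (X_i)_{i≥1} of real-valued random variables and a bounded, measurable, symmetric function h : ℝ × ℝ → ℝ such that the sequence ((1/binom(n,2)) ∑_{1≤i<j≤n} h(X_i, X_j))_{n≥2} does not converge in probability. -/
open MeasureTheory Filter Topology

/-- Sum over pairs of a lag function supported below `L` is at most `n * L`. -/
lemma stmt6_aux_bound (b : ℕ → ℝ) (hb1 : ∀ k, b k ≤ 1) (n L : ℕ)
    (hb : ∀ k, L ≤ k → k < n → b k = 0) (hb0 : ∀ k, 0 ≤ b k) :
    ∑ j ∈ Finset.Icc 1 n, ∑ i ∈ Finset.Ico 1 j, b (j - i) ≤ (n : ℝ) * L := by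
  have key : ∀ j ∈ Finset.Icc 1 n, ∑ i ∈ Finset.Ico 1 j, b (j - i) ≤ (L : ℝ) := by
    intro j hj
    rw [Finset.mem_Icc] at hj
    have h1 : ∑ i ∈ Finset.Ico 1 j, b (j - i)
        ≤ ∑ i ∈ Finset.Ico 1 j, if i ∈ Finset.Ico (j - L) j then (1 : ℝ) else 0 := by
      apply Finset.sum_le_sum
      intro i hi
      rw [Finset.mem_Ico] at hi
      split_ifs with h
      · exact hb1 _
      · rw [Finset.mem_Ico] at h
        rw [hb (j - i) (by omega) (by omega)]
    refine h1.trans ?_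
    rw [← Finset.sum_filter, Finset.sum_const, nsmul_eq_mul, mul_one]
    norm_cast
    calc _ ≤ (Finset.Ico (j - L) j).card := by
          apply Finset.card_le_card
          intro i hi
          exact (Finset.mem_filter.1 hi).2
      _ ≤ L := by rw [Nat.card_Ico]; omega
  calc _ ≤ ∑ j ∈ Finset.Icc 1 n, (L : ℝ) := Finset.sum_le_sum key
    _ = _ := by simp

lemma stmt6_aux_total (n : ℕ) :
    ∑ j ∈ Finset.Icc 1 n, ∑ _i ∈ Finset.Ico 1 j, (1 : ℝ) = (n.choose 2 : ℝ) := by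
  induction n with
  | zero => simp
  | succ n ih =>
    rw [Finset.sum_Icc_succ_top (by omega), ih, Nat.choose_succ_succ' n 1]
    simp
    ring

lemma stmt6_aux_choose (L : ℕ) (hL : 1 ≤ L) :
    0 < (((16 * L).choose 2 : ℕ) : ℝ) ∧
    ((16 * L : ℕ) : ℝ) * L ≤ (((16 * L).choose 2 : ℕ) : ℝ) * (1 / 4) := by
  rw [Nat.cast_choose_two]
  have : (1 : ℝ) ≤ L := by exact_mod_cast hL
  push_cast
  constructor <;> nlinarith

open Classical in
/-- The lag weights. -/
noncomputable def stmt6_a (k : ℕ) : ℝ := if Even (Nat.log 16 k) then 1 else 0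

noncomputable def stmt6_c (n : ℕ) : ℝ := (n.choose 2 : ℝ)⁻¹ *
  ∑ j ∈ Finset.Icc 1 n, ∑ i ∈ Finset.Ico 1 j, stmt6_a (j - i)

lemma stmt6_log {m k : ℕ} (h1 : 16 ^ m ≤ k) (h2 : k < 16 * 16 ^ m) : Nat.log 16 k = m := by
  rw [mul_comm, ← pow_succ] at h2
  exact Nat.log_eq_of_pow_le_of_lt_pow h1 h2

lemma stmt6_low (m : ℕ) : stmt6_c (16 * 16 ^ (2 * m + 1)) ≤ 1 / 4 := by
  obtain ⟨h0, h1⟩ := stmt6_aux_choose (16 ^ (2 * m + 1)) (by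
    exact Nat.one_le_pow _ _ (by norm_num))
  unfold stmt6_c
  rw [inv_mul_le_iff₀ h0]
  refine (stmt6_aux_bound _ ?_ _ (16 ^ (2 * m + 1)) ?_ ?_).trans h1
  · intro k; unfold stmt6_a; split_ifs <;> norm_num
  · intro k hk hk'
    rw [stmt6_a, stmt6_log hk hk', if_neg]
    simp
  · intro k; unfold stmt6_a; split_ifs <;> norm_num

lemma stmt6_high (m : ℕ) : 3 / 4 ≤ stmt6_c (16 * 16 ^ (2 * m)) := by
  obtain ⟨h0, h1⟩ := stmt6_aux_choose (16 ^ (2 * m)) (Nat.one_le_pow _ _ (by norm_num))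
  have h2 := (stmt6_aux_bound (fun k => 1 - stmt6_a k) ?_ (16 * 16 ^ (2 * m))
    (16 ^ (2 * m)) ?_ ?_).trans h1
  · simp only [Finset.sum_sub_distrib] at h2
    rw [stmt6_aux_total] at h2
    unfold stmt6_c
    rw [le_inv_mul_iff₀ h0]
    linarith
  · intro k; unfold stmt6_a; split_ifs <;> norm_num
  · intro k hk hk'
    simp only [stmt6_a]
    rw [stmt6_log hk hk', if_pos]
    · simp
    · simp
  · intro k; unfold stmt6_a; split_ifs <;> norm_num

lemma stmt6_nonconv {Ω : Type} [MeasurableSpace Ω] (μ : Measure Ω) [IsProbabilityMeasure μ]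
    (Y : Ω → ℝ) (hY : TendstoInMeasure μ (fun n (_ : Ω) => stmt6_c n) atTop Y) : False := by
  have t1 : Tendsto (fun m : ℕ => 16 * 16 ^ (2 * m)) atTop (atTop : Filter ℕ) := by
    apply StrictMono.tendsto_atTop
    intro a b hab
    have := Nat.pow_lt_pow_right (a := 16) (by norm_num) (show 2 * a < 2 * b by omega)
    show 16 * 16 ^ (2 * a) < 16 * 16 ^ (2 * b)
    omega
  have t2 : Tendsto (fun m : ℕ => 16 * 16 ^ (2 * m + 1)) atTop (atTop : Filter ℕ) := by
    apply StrictMono.tendsto_atTop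
    intro a b hab
    have := Nat.pow_lt_pow_right (a := 16) (by norm_num) (show 2 * a + 1 < 2 * b + 1 by omega)
    show 16 * 16 ^ (2 * a + 1) < 16 * 16 ^ (2 * b + 1)
    omega
  obtain ⟨n1, -, h1⟩ := (hY.comp t1).exists_seq_tendsto_ae
  obtain ⟨n2, -, h2⟩ := (hY.comp t2).exists_seq_tendsto_ae
  obtain ⟨ω, h3, h4⟩ := (h1.and h2).exists
  have h5 := ge_of_tendsto' h3 (fun i => stmt6_high (n1 i))
  have h6 := le_of_tendsto' h4 (fun i => stmt6_low (n2 i))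
  linarith

/-- The set of differences defining the kernel. -/
def stmt6_S (α : UnitAddCircle) : Set UnitAddCircle :=
  {z | ∃ k : ℕ, Even (Nat.log 16 k) ∧ (z = k • α ∨ z = -(k • α))}

lemma stmt6_S_countable (α : UnitAddCircle) : (stmt6_S α).Countable := by
  apply ((Set.countable_range (fun k : ℕ => k • α)).union
    (Set.countable_range (fun k : ℕ => -(k • α)))).mono
  rintro z ⟨k, -, h | h⟩
  · exact Or.inl ⟨k, h.symm⟩
  · exact Or.inr ⟨k, h.symm⟩

lemma stmt6_S_iff (α : UnitAddCircle) (hα : addOrderOf α = 0) (k : ℕ) (hk : 0 < k) :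
    -(k • α) ∈ stmt6_S α ↔ Even (Nat.log 16 k) := by
  have inj := injective_nsmul_iff_not_isOfFinAddOrder.2 (addOrderOf_eq_zero_iff.1 hα)
  constructor
  · rintro ⟨l, hl, h | h⟩
    · exfalso
      have h' : (k + l) • α = 0 • α := by rw [add_nsmul, ← h]; simp
      have := inj h'
      omega
    · have : k = l := inj (neg_injective h)
      rwa [this]
  · intro h
    exact ⟨k, h, Or.inr rfl⟩

lemma stmt6_exists : ∃ α : UnitAddCircle, addOrderOf α = 0 := by
  refine ⟨((√2 : ℝ) : UnitAddCircle), ?_⟩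
  rw [← AddCircle.denseRange_zsmul_iff, AddCircle.denseRange_zsmul_coe_iff, div_one]
  exact irrational_sqrt_two

/-- There exist a strictly stationary ergodic real sequence `(X_i)_{i ≥ 1}` and a bounded
measurable symmetric kernel `h` such that the U-statistics
`(1/binom(n,2)) ∑_{1≤i<j≤n} h(X_i, X_j)` do not converge in probability (to any random
variable). Stationarity and ergodicity are encoded by requiring that the law of the path
`(X_1, X_2, …)` is invariant and ergodic under the one-sided shift. -/
theorem stmt6 :
    ∃ (Ω : Type) (_ : MeasurableSpace Ω) (μ : Measure Ω),
      IsProbabilityMeasure μ ∧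
      ∃ X : ℕ → Ω → ℝ,
        (∀ i, Measurable (X i)) ∧
        Ergodic (fun u : ℕ → ℝ => fun n => u (n + 1))
          (Measure.map (fun ω => fun n => X (n + 1) ω) μ) ∧
        ∃ h : ℝ → ℝ → ℝ,
          Measurable (Function.uncurry h) ∧
          (∃ C : ℝ, ∀ x y, |h x y| ≤ C) ∧
          (∀ x y, h x y = h y x) ∧
          ¬ ∃ Y : Ω → ℝ, TendstoInMeasure μ
              (fun (n : ℕ) (ω : Ω) => (n.choose 2 : ℝ)⁻¹ *
                ∑ j ∈ Finset.Icc 1 n, ∑ i ∈ Finset.Ico 1 j, h (X i ω) (X j ω))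
              atTop Y := by
  classical
  obtain ⟨α, hα⟩ := stmt6_exists
  let e : UnitAddCircle → ℝ := fun z => (AddCircle.measurableEquivIco 1 0 z : ℝ)
  have he : Measurable e :=
    measurable_subtype_coe.comp (AddCircle.measurableEquivIco (1 : ℝ) 0).measurable
  have hee : ∀ z, ((e z : ℝ) : UnitAddCircle) = z := fun z => AddCircle.coe_equivIco
  have hcoe : Measurable (fun x : ℝ => (x : UnitAddCircle)) := AddCircle.measurable_mk'
  let X : ℕ → UnitAddCircle → ℝ := fun i ω => e (ω + i • α)
  have hX : ∀ i, Measurable (X i) := fun i => he.comp (measurable_id.add_const _)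
  have hP : IsProbabilityMeasure (volume : Measure UnitAddCircle) :=
    ⟨UnitAddCircle.measure_univ⟩
  refine ⟨UnitAddCircle, inferInstance, volume, hP, X, hX, ?_, ?_⟩
  · have hF : Measurable (fun ω => fun n => X (n + 1) ω) :=
      measurable_pi_lambda _ (fun n => hX (n + 1))
    refine MeasurePreserving.ergodic_of_ergodic_semiconj (hF.measurePreserving volume)
      (AddCircle.ergodic_add_right.2 hα) ?_ ?_
    · exact measurable_pi_lambda _ (fun n => measurable_pi_apply _)
    · intro ω
      funext n
      show e (ω + α + (n + 1) • α) = e (ω + (n + 1 + 1) • α)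
      congr 1
      rw [add_nsmul _ (n + 1) 1]
      abel
  · refine ⟨fun x y => (stmt6_S α).indicator (fun _ => (1 : ℝ))
      ((x : UnitAddCircle) - (y : UnitAddCircle)), ?_, ⟨1, ?_⟩, ?_, ?_⟩
    · exact (measurable_const.indicator (stmt6_S_countable α).measurableSet).comp
        ((hcoe.comp measurable_fst).sub (hcoe.comp measurable_snd))
    · intro x y
      simp only [Set.indicator_apply]
      split_ifs <;> simp
    · intro x y
      have : ∀ z, z ∈ stmt6_S α → -z ∈ stmt6_S α := by
        rintro z ⟨k, hk, h | h⟩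
        · exact ⟨k, hk, Or.inr (by rw [h])⟩
        · exact ⟨k, hk, Or.inl (by rw [h, neg_neg])⟩
      have h2 : ((x : UnitAddCircle) - y) ∈ stmt6_S α ↔ ((y : UnitAddCircle) - x) ∈ stmt6_S α :=
        ⟨fun h => by simpa using this _ h, fun h => by simpa using this _ h⟩
      simp only [Set.indicator_apply, h2]
    · rintro ⟨Y, hY⟩
      refine stmt6_nonconv volume Y ?_
      refine (congrArg (fun f => TendstoInMeasure volume f atTop Y) ?_).mp hY
      funext n ω
      symm
      unfold stmt6_c
      congr 1
      refine Finset.sum_congr rfl fun j _ => Finset.sum_congr rfl fun i hi => ?_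
      rw [Finset.mem_Ico] at hi
      simp only [X, hee]
      have h1 : ω + i • α - (ω + j • α) = -((j - i) • α) := by
        have : j • α = (j - i) • α + i • α := by rw [← add_nsmul]; congr 1; omega
        rw [this]; abel
      rw [h1, Set.indicator_apply, stmt6_a]
      simp only [stmt6_S_iff α hα (j - i) (by omega)]
end

section
/- There exists a strictly stationary ergodic sequence (X_i)_{i≥1} of real-valued random variables and a measurable symmetric function h : ℝ × ℝ → ℝ such that E|h(X_i, X_j)| < ∞ for all 1 ≤ i < j, yet the sequence ((1/binom(n,2)) ∑_{1≤i<j≤n} (h(X_i, X_j) − E[h(X_i, X_j)]))_{n≥2} does not converge in probability. -/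
open MeasureTheory Filter Topology

lemma pairs_count (n : ℕ) (A : ℝ) :
    ∑ j ∈ Finset.Icc 1 n, ∑ _i ∈ Finset.Ico 1 j, A = (n.choose 2 : ℝ) * A := by
  induction n with
  | zero => simp
  | succ n ih =>
    rw [Finset.sum_Icc_succ_top (by omega), ih, Nat.choose_succ_succ' n 1]
    simp
    ring

lemma gap_bound (f : ℕ → ℝ) (hf : ∀ i, |f i| = 1) (n : ℕ) (hn : 2 ≤ n) :
    (n.choose 2 : ℝ) * (((n - 1).factorial : ℝ) ^ 2) ≤
      |∑ j ∈ Finset.Icc 1 n, ∑ i ∈ Finset.Ico 1 j,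
        (((j - i + 1).factorial : ℝ) ^ 2) * f i| := by
  set A : ℝ := ((n - 1).factorial : ℝ) ^ 2 with hA
  set t : ℕ → ℕ → ℝ := fun j i => (((j - i + 1).factorial : ℝ) ^ 2) * f i with ht
  set e : ℕ → ℕ → ℝ := fun j i => if j = n then (if i = 1 then t n 1 else 0) else 0 with he
  have h1 : ∑ j ∈ Finset.Icc 1 n, ∑ i ∈ Finset.Ico 1 j, e j i = t n 1 := by
    rw [Finset.sum_eq_single n]
    · rw [Finset.sum_eq_single 1]
      · simp [he]
      · intro b _ hb; simp [he, hb]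
      · intro h; simp at h; omega
    · intro b _ hb; simp [he, hb]
    · intro h; simp at h; omega
  have h2 : |∑ j ∈ Finset.Icc 1 n, ∑ i ∈ Finset.Ico 1 j, (t j i - e j i)| ≤
      (n.choose 2 : ℝ) * A := by
    rw [← pairs_count]
    refine (Finset.abs_sum_le_sum_abs _ _).trans (Finset.sum_le_sum fun j hj => ?_)
    refine (Finset.abs_sum_le_sum_abs _ _).trans (Finset.sum_le_sum fun i hi => ?_)
    rw [Finset.mem_Icc] at hj
    rw [Finset.mem_Ico] at hi
    by_cases hc : j = n ∧ i = 1
    · obtain ⟨rfl, rfl⟩ := hc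
      simp [he]
      positivity
    · have : e j i = 0 := by
        simp only [he]
        split_ifs with h3 h4
        · exact absurd ⟨h3, h4⟩ hc
        · rfl
        · rfl
      rw [this, sub_zero, ht]
      simp only [abs_mul, hf, mul_one]
      rw [abs_of_nonneg (by positivity), hA]
      have : (j - i + 1).factorial ≤ (n - 1).factorial := Nat.factorial_le (by omega)
      gcongr
  have h3 : |t n 1| = (n : ℝ) ^ 2 * A := by
    simp only [ht, abs_mul, hf, mul_one]
    rw [abs_of_nonneg (by positivity), hA, ← mul_pow]
    congr 1
    obtain ⟨m, rfl⟩ : ∃ m, n = m + 2 := ⟨n - 2, by omega⟩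
    simp only [Nat.add_sub_cancel, show m + 2 - 1 = m + 1 from rfl,
      Nat.factorial_succ (m + 1)]
    push_cast; ring
  have h4 : 2 * (n.choose 2 : ℝ) ≤ (n : ℝ) ^ 2 := by
    rw [Nat.cast_choose_two]
    have : (0:ℝ) ≤ n := by positivity
    nlinarith
  have h5 : ∑ j ∈ Finset.Icc 1 n, ∑ i ∈ Finset.Ico 1 j, t j i =
      ∑ j ∈ Finset.Icc 1 n, ∑ i ∈ Finset.Ico 1 j, (t j i - e j i) + t n 1 := by
    rw [← h1]
    simp [Finset.sum_sub_distrib]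
  have hA0 : 0 ≤ A := by positivity
  change _ ≤ |∑ j ∈ Finset.Icc 1 n, ∑ i ∈ Finset.Ico 1 j, t j i|
  rw [h5]
  have h6 := abs_sub_abs_le_abs_sub (t n 1)
    (-(∑ j ∈ Finset.Icc 1 n, ∑ i ∈ Finset.Ico 1 j, (t j i - e j i)))
  rw [abs_neg, sub_neg_eq_add, add_comm (t n 1)] at h6
  nlinarith

/-- The coordinate of a point of the circle in the interval `(0, 1]`. -/
noncomputable def circCoord (ω : UnitAddCircle) : ℝ := (AddCircle.measurableEquivIoc 1 0 ω : ℝ)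

/-- A sign function. -/
noncomputable def sgnHalf (x : ℝ) : ℝ := if x ≤ 1 / 2 then 1 else -1

/-- The irrational angle. -/
noncomputable def ang : UnitAddCircle := ((Real.sqrt 2 : ℝ) : UnitAddCircle)

/-- The weight of a difference: `((k+1)!)^2` on `k • ang` (`k ≥ 1`), and zero elsewhere. -/
noncomputable def gapWeight : UnitAddCircle → ℝ :=
  Function.extend (fun k : ℕ => (k + 1) • ang) (fun k => (((k + 1 + 1).factorial : ℝ) ^ 2)) 0

/-- The kernel. -/
noncomputable def kern (x y : ℝ) : ℝ :=
  gapWeight ((y : UnitAddCircle) - (x : UnitAddCircle)) * sgnHalf x +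
  gapWeight ((x : UnitAddCircle) - (y : UnitAddCircle)) * sgnHalf y

/-- The process. -/
noncomputable def proc (i : ℕ) (ω : UnitAddCircle) : ℝ := circCoord (ω + i • ang)

lemma measurable_circCoord : Measurable circCoord :=
  measurable_subtype_coe.comp (AddCircle.measurableEquivIoc 1 0).measurable

lemma coe_circCoord (ω : UnitAddCircle) : ((circCoord ω : ℝ) : UnitAddCircle) = ω :=
  (AddCircle.equivIoc 1 0).left_inv ω

lemma circCoord_coe {x : ℝ} (hx : x ∈ Set.Ioc (0:ℝ) 1) :
    circCoord (x : UnitAddCircle) = x := by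
  have hx' : x ∈ Set.Ioc (0:ℝ) (0 + 1) := by simpa using hx
  exact congrArg Subtype.val ((AddCircle.equivIoc (1:ℝ) 0).right_inv ⟨x, hx'⟩)

lemma measurable_sgnHalf : Measurable sgnHalf :=
  Measurable.ite measurableSet_Iic measurable_const measurable_const

lemma abs_sgnHalf (x : ℝ) : |sgnHalf x| = 1 := by
  unfold sgnHalf; split_ifs <;> simp

lemma ang_order : addOrderOf ang = 0 := by
  rw [← AddCircle.denseRange_zsmul_iff]
  unfold ang
  rw [AddCircle.denseRange_zsmul_coe_iff]
  simpa using irrational_sqrt_two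

lemma ang_inj : Function.Injective (fun k : ℕ => k • ang) :=
  injective_nsmul_iff_not_isOfFinAddOrder.2 (addOrderOf_eq_zero_iff.1 ang_order)

lemma ang_inj' : Function.Injective (fun k : ℕ => (k + 1) • ang) := fun a b hab => by
  have := ang_inj hab
  omega

lemma gapWeight_pos (k : ℕ) (hk : 1 ≤ k) :
    gapWeight (k • ang) = (((k + 1).factorial : ℝ) ^ 2) := by
  obtain ⟨m, rfl⟩ : ∃ m, k = m + 1 := ⟨k - 1, by omega⟩
  exact ang_inj'.extend_apply _ _ m

lemma gapWeight_neg (k : ℕ) : gapWeight (-(k • ang)) = 0 := by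
  unfold gapWeight
  rw [Function.extend_apply']
  · rfl
  · rintro ⟨m, hm⟩
    have h0 : (m + 1 + k) • ang = 0 • ang := by
      rw [add_nsmul, zero_nsmul]
      rw [hm]; simp
    have := ang_inj h0
    omega

lemma measurable_gapWeight : Measurable gapWeight := by
  refine (measurable_zero (α := ℝ) (β := UnitAddCircle)).measurable_of_countable_ne ?_
  refine (Set.countable_range (fun k : ℕ => (k + 1) • ang)).mono ?_
  intro x hx
  by_contra hx'
  apply hx
  unfold gapWeight
  rw [Function.extend_apply' _ _ _ hx']

lemma measurable_kern : Measurable (Function.uncurry kern) := by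
  have hc : Measurable (fun x : ℝ => (x : UnitAddCircle)) := AddCircle.measurable_mk'
  have h1 : Measurable (fun p : ℝ × ℝ => (p.1 : UnitAddCircle)) := hc.comp measurable_fst
  have h2 : Measurable (fun p : ℝ × ℝ => (p.2 : UnitAddCircle)) := hc.comp measurable_snd
  exact ((measurable_gapWeight.comp (h2.sub h1)).mul
    (measurable_sgnHalf.comp measurable_fst)).add
    ((measurable_gapWeight.comp (h1.sub h2)).mul (measurable_sgnHalf.comp measurable_snd))

lemma measurable_proc (i : ℕ) : Measurable (proc i) :=
  measurable_circCoord.comp (measurable_id.add_const _)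

lemma kern_proc (i j : ℕ) (hij : i < j) (ω : UnitAddCircle) :
    kern (proc i ω) (proc j ω) = (((j - i + 1).factorial : ℝ) ^ 2) * sgnHalf (proc i ω) := by
  obtain ⟨k, rfl⟩ : ∃ k, j = i + k := ⟨j - i, by omega⟩
  have hk : 1 ≤ k := by omega
  unfold kern
  simp only [proc, coe_circCoord]
  have e1 : ω + (i + k) • ang - (ω + i • ang) = k • ang := by rw [add_nsmul]; abel
  have e2 : ω + i • ang - (ω + (i + k) • ang) = -(k • ang) := by rw [add_nsmul]; abel
  rw [e1, e2, gapWeight_pos k hk, gapWeight_neg]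
  simp

lemma integral_sgn : ∫ ω : UnitAddCircle, sgnHalf (circCoord ω) = 0 := by
  rw [← UnitAddCircle.intervalIntegral_preimage 0, zero_add]
  have h1 : ∫ a in (0:ℝ)..(1/2), sgnHalf (circCoord (a : UnitAddCircle)) = 1 / 2 := by
    rw [intervalIntegral.integral_congr_uIoo (g := fun _ => (1:ℝ))]
    · simp
    · intro x hx
      rw [Set.uIoo_of_le (by norm_num)] at hx
      simp only
      rw [circCoord_coe ⟨hx.1, by linarith [hx.2]⟩, sgnHalf, if_pos hx.2.le]
  have h2 : ∫ a in (1/2:ℝ)..1, sgnHalf (circCoord (a : UnitAddCircle)) = -(1 / 2) := by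
    rw [intervalIntegral.integral_congr_uIoo (g := fun _ => (-1:ℝ))]
    · simp; norm_num
    · intro x hx
      rw [Set.uIoo_of_le (by norm_num)] at hx
      simp only
      rw [circCoord_coe ⟨by linarith [hx.1], hx.2.le⟩, sgnHalf, if_neg (not_le.2 hx.1)]
  have hi : ∀ a b : ℝ, IntervalIntegrable
      (fun a : ℝ => sgnHalf (circCoord (a : UnitAddCircle))) volume a b := by
    intro a b
    have hb : ∀ s : Set ℝ, volume s ≠ ⊤ →
        IntegrableOn (fun a : ℝ => sgnHalf (circCoord (a : UnitAddCircle))) s volume := by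
      intro s hs
      have : IsFiniteMeasure (volume.restrict s) := ⟨by simpa using hs.lt_top⟩
      refine Integrable.of_bound (C := 1) (measurable_sgnHalf.comp
        (measurable_circCoord.comp AddCircle.measurable_mk')).aestronglyMeasurable
        (ae_of_all _ fun x => ?_)
      simp only [Real.norm_eq_abs, abs_sgnHalf, le_refl]
    exact ⟨hb _ (by simp), hb _ (by simp)⟩
  rw [← intervalIntegral.integral_add_adjacent_intervals (hi 0 (1/2)) (hi (1/2) 1), h1, h2]
  norm_num

lemma integral_sgn_proc (i : ℕ) : ∫ ω : UnitAddCircle, sgnHalf (proc i ω) = 0 := by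
  rw [← integral_sgn]
  exact integral_add_right_eq_self (fun ω => sgnHalf (circCoord ω)) (i • ang)

lemma ergodic_proc : Ergodic (fun u : ℕ → ℝ => fun n => u (n + 1))
    (Measure.map (fun ω => fun n => proc (n + 1) ω) (volume : Measure UnitAddCircle)) := by
  have hm : Measurable (fun (ω : UnitAddCircle) => fun n => proc (n + 1) ω) :=
    measurable_pi_lambda _ fun n => measurable_proc _
  refine (hm.measurePreserving _).ergodic_of_ergodic_semiconj
    (AddCircle.ergodic_add_right.2 ang_order) ?_ ?_
  rotate_left
  · intro ω
    funext n
    simp only [proc]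
    congr 1
    rw [add_nsmul _ (n + 1) 1, one_nsmul]; abel
  · exact measurable_pi_lambda _ fun n => measurable_pi_apply _

/-- There exist a strictly stationary ergodic real sequence `(X_i)_{i ≥ 1}` and a
measurable symmetric kernel `h` with `E|h(X_i, X_j)| < ∞` for all `1 ≤ i < j`, such that
the centered U-statistics `(1/binom(n,2)) ∑_{1≤i<j≤n} (h(X_i,X_j) − E[h(X_i,X_j)])` do
not converge in probability (to any random variable). Stationarity and ergodicity are
encoded by requiring that the law of the path `(X_1, X_2, …)` is invariant and ergodic
under the one-sided shift. -/
theorem stmt7 :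
    ∃ (Ω : Type) (_ : MeasurableSpace Ω) (μ : Measure Ω),
      IsProbabilityMeasure μ ∧
      ∃ X : ℕ → Ω → ℝ,
        (∀ i, Measurable (X i)) ∧
        Ergodic (fun u : ℕ → ℝ => fun n => u (n + 1))
          (Measure.map (fun ω => fun n => X (n + 1) ω) μ) ∧
        ∃ h : ℝ → ℝ → ℝ,
          Measurable (Function.uncurry h) ∧
          (∀ x y, h x y = h y x) ∧
          (∀ i j, 1 ≤ i → i < j → Integrable (fun ω => h (X i ω) (X j ω)) μ) ∧
          ¬ ∃ Y : Ω → ℝ, TendstoInMeasure μ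
              (fun (n : ℕ) (ω : Ω) => (n.choose 2 : ℝ)⁻¹ *
                ∑ j ∈ Finset.Icc 1 n, ∑ i ∈ Finset.Ico 1 j,
                  (h (X i ω) (X j ω) - ∫ ω', h (X i ω') (X j ω') ∂μ))
              atTop Y := by
  refine ⟨UnitAddCircle, inferInstance, volume, ⟨UnitAddCircle.measure_univ⟩, proc, measurable_proc,
    ergodic_proc, kern, measurable_kern, fun x y => by unfold kern; ring, ?_, ?_⟩
  · intro i j _ hij
    simp only [kern_proc i j hij]
    refine Integrable.const_mul ?_ _
    refine Integrable.of_bound (C := 1)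
      (measurable_sgnHalf.comp (measurable_proc i)).aestronglyMeasurable (ae_of_all _ fun ω => ?_)
    simp only [Real.norm_eq_abs, abs_sgnHalf, le_refl]
  · rintro ⟨Y, hY⟩
    obtain ⟨ns, hns, hae⟩ := hY.exists_seq_tendsto_ae
    obtain ⟨ω, hω⟩ := hae.exists
    have hlow : ∀ n : ℕ, 2 ≤ n → (n : ℝ) - 1 ≤ |(n.choose 2 : ℝ)⁻¹ *
        ∑ j ∈ Finset.Icc 1 n, ∑ i ∈ Finset.Ico 1 j,
          (kern (proc i ω) (proc j ω) - ∫ ω', kern (proc i ω') (proc j ω'))| := by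
      intro n hn
      have hs : ∑ j ∈ Finset.Icc 1 n, ∑ i ∈ Finset.Ico 1 j,
          (kern (proc i ω) (proc j ω) - ∫ ω', kern (proc i ω') (proc j ω')) =
          ∑ j ∈ Finset.Icc 1 n, ∑ i ∈ Finset.Ico 1 j,
            (((j - i + 1).factorial : ℝ) ^ 2) * sgnHalf (proc i ω) := by
        refine Finset.sum_congr rfl fun j _ => Finset.sum_congr rfl fun i hi => ?_
        have hij := (Finset.mem_Ico.1 hi).2
        simp only [kern_proc i j hij]
        rw [integral_const_mul, integral_sgn_proc]
        simp
      have hb := gap_bound (fun i => sgnHalf (proc i ω)) (fun i => abs_sgnHalf _) n hn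
      have hc : (0:ℝ) < n.choose 2 := by exact_mod_cast Nat.choose_pos hn
      rw [hs, abs_mul, abs_of_pos (inv_pos.2 hc), ← div_eq_inv_mul, le_div_iff₀ hc, mul_comm]
      refine le_trans ?_ hb
      gcongr
      have h1 : ((n - 1 : ℕ) : ℝ) = (n : ℝ) - 1 := by
        rw [Nat.cast_sub (by omega)]; simp
      have h2 : n - 1 ≤ (n - 1).factorial ^ 2 :=
        (Nat.self_le_factorial _).trans (Nat.le_self_pow (by norm_num) _)
      rw [← h1]
      exact_mod_cast h2
    have hinf : Tendsto (fun k : ℕ => ((ns k : ℕ) : ℝ) - 1) atTop atTop :=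
      tendsto_atTop_add_const_right _ _
        (tendsto_natCast_atTop_atTop.comp hns.tendsto_atTop)
    have habs := hω.abs
    refine not_tendsto_atTop_of_tendsto_nhds habs (tendsto_atTop_mono' _ ?_ hinf)
    filter_upwards [hns.tendsto_atTop.eventually_ge_atTop 2] with k hk
    exact hlow _ hk
end

section
/- Let (N_ℓ)_{ℓ≥1} and (N'_ℓ)_{ℓ≥0} be sequences of positive integers with N'_0 = 1, N_ℓ < N'_ℓ < N_{ℓ+1} for all ℓ ≥ 1, N'_ℓ / N_ℓ ≥ ℓ, and N_{ℓ+1} / N'_ℓ → ∞. Define I = ⋃_{ℓ≥0} {k ∈ ℕ : N'_ℓ < k ≤ N_{ℓ+1}}. Then, as ℓ → ∞, (1/(N_ℓ(N_ℓ−1))) ∑_{1≤i<j≤N_ℓ} 1_I(j−i) → 1/2 and (1/(N'_ℓ(N'_ℓ−1))) ∑_{1≤i<j≤N'_ℓ} 1_I(j−i) → 0. -/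
open Filter Topology

theorem aux_count_s10 (A : Set ℕ) (M a : ℕ) (h : ∀ k, k < M → k ∈ A → k ≤ a) :
    ∑ j ∈ Finset.Icc 1 M, ∑ i ∈ Finset.Ico 1 j,
      Set.indicator A (fun _ => (1 : ℝ)) (j - i) ≤ (M : ℝ) * a := by
  classical
  have key : ∀ j ∈ Finset.Icc 1 M, ∑ i ∈ Finset.Ico 1 j,
      Set.indicator A (fun _ => (1 : ℝ)) (j - i) ≤ (a : ℝ) := by
    intro j hj
    rw [Finset.mem_Icc] at hj
    simp only [Set.indicator_apply]
    rw [Finset.sum_boole]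
    have hsub : (Finset.Ico 1 j).filter (fun i => j - i ∈ A) ⊆ Finset.Ico (j - a) j := by
      intro i hi
      rw [Finset.mem_filter, Finset.mem_Ico] at hi
      have := h (j - i) (by omega) hi.2
      rw [Finset.mem_Ico]
      omega
    have hc := Finset.card_le_card hsub
    rw [Nat.card_Ico] at hc
    have : ((Finset.Ico 1 j).filter (fun i => j - i ∈ A)).card ≤ a := by omega
    exact_mod_cast this
  calc _ ≤ ∑ j ∈ Finset.Icc 1 M, (a : ℝ) := Finset.sum_le_sum key
    _ = _ := by simp

theorem aux_nonneg (A : Set ℕ) (M : ℕ) :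
    0 ≤ ∑ j ∈ Finset.Icc 1 M, ∑ i ∈ Finset.Ico 1 j,
      Set.indicator A (fun _ => (1 : ℝ)) (j - i) :=
  Finset.sum_nonneg fun _ _ => Finset.sum_nonneg fun _ _ =>
    Set.indicator_nonneg (fun _ _ => zero_le_one) _

theorem aux_total (M : ℕ) :
    ∑ j ∈ Finset.Icc 1 M, ∑ _i ∈ Finset.Ico 1 j, (1 : ℝ) = (M : ℝ) * ((M : ℝ) - 1) / 2 := by
  induction M with
  | zero => simp
  | succ n ih =>
    rw [Finset.sum_Icc_succ_top (by omega), ih]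
    simp
    ring

theorem aux_compl (A : Set ℕ) (M : ℕ) :
    (∑ j ∈ Finset.Icc 1 M, ∑ i ∈ Finset.Ico 1 j,
      Set.indicator A (fun _ => (1 : ℝ)) (j - i)) +
    (∑ j ∈ Finset.Icc 1 M, ∑ i ∈ Finset.Ico 1 j,
      Set.indicator Aᶜ (fun _ => (1 : ℝ)) (j - i)) = (M : ℝ) * ((M : ℝ) - 1) / 2 := by
  rw [← aux_total, ← Finset.sum_add_distrib]
  refine Finset.sum_congr rfl fun j _ => ?_
  rw [← Finset.sum_add_distrib]
  refine Finset.sum_congr rfl fun i _ => ?_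
  exact Set.indicator_self_add_compl_apply A (fun _ => (1 : ℝ)) (j - i)

theorem aux_bound (M a S : ℝ) (hM : 2 ≤ M) (ha : 0 ≤ a) (h : S ≤ M * a) :
    (M * (M - 1))⁻¹ * S ≤ 2 * (a / M) := by
  have h1 : 0 < M * (M - 1) := by nlinarith
  rw [inv_mul_le_iff₀ h1]
  have : M * (M - 1) * (2 * (a / M)) = 2 * a * (M - 1) := by
    field_simp
  rw [this]
  nlinarith [mul_nonneg ha (sub_nonneg.2 hM)]

/-- For sequences of positive integers `(N_ℓ)`, `(N'_ℓ)` with `N'_0 = 1`,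
`N_ℓ < N'_ℓ < N_{ℓ+1}`, `N'_ℓ/N_ℓ ≥ ℓ` and `N_{ℓ+1}/N'_ℓ → ∞`, and
`I = ⋃_ℓ {k : N'_ℓ < k ≤ N_{ℓ+1}}`, one has
`(1/(N_ℓ(N_ℓ−1))) ∑_{1≤i<j≤N_ℓ} 1_I(j−i) → 1/2` and
`(1/(N'_ℓ(N'_ℓ−1))) ∑_{1≤i<j≤N'_ℓ} 1_I(j−i) → 0`. -/
theorem stmt10 (N N' : ℕ → ℕ)
    (hNpos : ∀ ℓ, 1 ≤ N ℓ) (hN'pos : ∀ ℓ, 1 ≤ N' ℓ)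
    (hN'0 : N' 0 = 1)
    (horder : ∀ ℓ, 1 ≤ ℓ → N ℓ < N' ℓ ∧ N' ℓ < N (ℓ + 1))
    (hratio : ∀ ℓ : ℕ, 1 ≤ ℓ → (ℓ : ℝ) ≤ (N' ℓ : ℝ) / (N ℓ : ℝ))
    (hlim : Tendsto (fun ℓ : ℕ => (N (ℓ + 1) : ℝ) / (N' ℓ : ℝ)) atTop atTop)
    (I : Set ℕ) (hI : I = ⋃ ℓ : ℕ, {k : ℕ | N' ℓ < k ∧ k ≤ N (ℓ + 1)}) :
    Tendsto (fun ℓ : ℕ => ((N ℓ : ℝ) * ((N ℓ : ℝ) - 1))⁻¹ *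
        ∑ j ∈ Finset.Icc 1 (N ℓ), ∑ i ∈ Finset.Ico 1 j,
          Set.indicator I (fun _ => (1 : ℝ)) (j - i))
      atTop (𝓝 (1 / 2)) ∧
    Tendsto (fun ℓ : ℕ => ((N' ℓ : ℝ) * ((N' ℓ : ℝ) - 1))⁻¹ *
        ∑ j ∈ Finset.Icc 1 (N' ℓ), ∑ i ∈ Finset.Ico 1 j,
          Set.indicator I (fun _ => (1 : ℝ)) (j - i))
      atTop (𝓝 0) := by
  have hmono : ∀ ℓ m, 1 ≤ ℓ → ℓ ≤ m → N ℓ ≤ N m ∧ N' ℓ ≤ N' m := by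
    intro ℓ m hℓ hm
    induction m, hm using Nat.le_induction with
    | base => exact ⟨le_rfl, le_rfl⟩
    | succ m hm ih =>
      have h1 := horder m (by omega)
      have h2 := horder (m + 1) (by omega)
      omega
  constructor
  · rw [← tendsto_add_atTop_iff_nat 1]
    have hz : Tendsto (fun ℓ : ℕ => 1 / 2 - 2 * ((N' ℓ : ℝ) / (N (ℓ + 1) : ℝ))) atTop
        (𝓝 (1 / 2)) := by
      have := hlim.inv_tendsto_atTop
      have h2 := (this.const_mul 2).const_sub (1 / 2)
      simpa using h2
    refine tendsto_of_tendsto_of_tendsto_of_le_of_le' hz tendsto_const_nhds ?_ ?_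
    all_goals
      filter_upwards [eventually_ge_atTop 1] with ℓ hℓ
      have ho := horder ℓ hℓ
      have hp := hN'pos ℓ
      have hM : (2 : ℝ) ≤ (N (ℓ + 1) : ℝ) := by
        have : 2 ≤ N (ℓ + 1) := by omega
        exact_mod_cast this
      have hc := aux_compl I (N (ℓ + 1))
      have hb := aux_bound (N (ℓ + 1)) (N' ℓ) _ hM (Nat.cast_nonneg _)
        (aux_count_s10 Iᶜ (N (ℓ + 1)) (N' ℓ) (by
          intro k hk hkI
          by_contra hlt
          apply hkI
          rw [hI, Set.mem_iUnion]
          exact ⟨ℓ, by simp only [Set.mem_setOf_eq]; omega⟩))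
      have hn := aux_nonneg Iᶜ (N (ℓ + 1))
      have hpos : 0 < (N (ℓ + 1) : ℝ) * ((N (ℓ + 1) : ℝ) - 1) := by nlinarith
      have hn2 := mul_nonneg (inv_nonneg.2 hpos.le) hn
      rw [eq_sub_of_add_eq hc, mul_sub]
      have he : ((N (ℓ + 1) : ℝ) * ((N (ℓ + 1) : ℝ) - 1))⁻¹ *
          ((N (ℓ + 1) : ℝ) * ((N (ℓ + 1) : ℝ) - 1) / 2) = 1 / 2 := by
        rw [← mul_div_assoc, inv_mul_cancel₀ hpos.ne']
      linarith
  · have hz : Tendsto (fun ℓ : ℕ => 2 * ((ℓ : ℝ))⁻¹) atTop (𝓝 0) := by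
      simpa using (tendsto_inv_atTop_nhds_zero_nat (𝕜 := ℝ)).const_mul 2
    refine tendsto_of_tendsto_of_tendsto_of_le_of_le' tendsto_const_nhds hz ?_ ?_
    all_goals
      filter_upwards [eventually_ge_atTop 1] with ℓ hℓ
      have ho := horder ℓ hℓ
      have hp := hNpos ℓ
      have hM : (2 : ℝ) ≤ (N' ℓ : ℝ) := by
        have : 2 ≤ N' ℓ := by omega
        exact_mod_cast this
    · have hpos : 0 < (N' ℓ : ℝ) * ((N' ℓ : ℝ) - 1) := by nlinarith
      exact mul_nonneg (inv_nonneg.2 hpos.le) (aux_nonneg I _)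
    · refine (aux_bound (N' ℓ) (N ℓ) _ hM (Nat.cast_nonneg _)
        (aux_count_s10 I (N' ℓ) (N ℓ) ?_)).trans ?_
      · intro k hk hkI
        rw [hI, Set.mem_iUnion] at hkI
        obtain ⟨m, h1, h2⟩ := hkI
        rcases le_or_gt ℓ m with hm | hm
        · have := (hmono ℓ m hℓ hm).2
          omega
        · have := (hmono (m + 1) ℓ (by omega) hm).1
          omega
      · have hr := hratio ℓ hℓ
        have hl : (0 : ℝ) < ℓ := by exact_mod_cast hℓ
        have := inv_anti₀ hl hr
        rw [inv_div] at this
        linarith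
end
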